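/- arXiv:1801.09140 — 2 statements merged into one kernel-verified Lean document; each statement's English description precedes it below -/
import Mathlib

section
/- Let r ≥ 3 and m ≥ 1, and let E = {e_1, …, e_r, a_1, …, a_m} be the vectors of the configuration E_{r,m}. Let γ_0 be the monotone path order e_1 ≺ e_2 ≺ ⋯ ≺ e_{r−1} ≺ a_1 ≺ ⋯ ≺ a_m ≺ e_r. Then in the polynomial ring ℤ[q], (∑_γ q^{L_2(γ_0, γ)}) · [m+1]_q! · [r−2]_q! = (1 + q^{m+2}) · [r−1]_q! · [m+r−1]_q!, where the sum ranges over all monotone path orders γ of E_{r,m}. -/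
open Finset

/-- The `q`-factorial `[k]_q! = ∏_{j=1}^{k} (1 + q + ⋯ + q^{j−1})` in `ℤ[q]`. -/
noncomputable def qfact (k : ℕ) : Polynomial ℤ :=
  ∏ j ∈ Finset.range k, ∑ i ∈ Finset.range (j + 1), Polynomial.X ^ i

section Erm

variable {r m : ℕ}

/-- A monotone path order of the vector family `v`: a strict total order such that each
vector is separated from its predecessors and successors by a linear functional. -/
def IsMonotonePathOrder (v : Fin r ⊕ Fin m → Fin r → ℝ)
    (prec : Fin r ⊕ Fin m → Fin r ⊕ Fin m → Prop) : Prop :=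
  IsStrictTotalOrder (Fin r ⊕ Fin m) prec ∧
  ∀ u : Fin r ⊕ Fin m, ∃ φ : (Fin r → ℝ) →ₗ[ℝ] ℝ,
    φ (v u) = 0 ∧ (∀ w, prec w u → φ (v w) < 0) ∧ (∀ w, prec u w → 0 < φ (v w))

/-- A rank-2 flat of the vector family `v`: a set `F` of indices with
`dim span (v '' F) = 2` which contains every index whose vector lies in `span (v '' F)`. -/
def IsRank2Flat (v : Fin r ⊕ Fin m → Fin r → ℝ) (F : Set (Fin r ⊕ Fin m)) : Prop :=
  Module.finrank ℝ (Submodule.span ℝ (v '' F)) = 2 ∧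
  ∀ u, v u ∈ Submodule.span ℝ (v '' F) → u ∈ F

/-- `L2dist v γ γ'` is the number of rank-2 flats on which the restrictions of the strict
total orders `γ` and `γ'` differ. -/
noncomputable def L2dist (v : Fin r ⊕ Fin m → Fin r → ℝ)
    (γ γ' : Fin r ⊕ Fin m → Fin r ⊕ Fin m → Prop) : ℕ :=
  {F : Set (Fin r ⊕ Fin m) | IsRank2Flat v F ∧
    ∃ u ∈ F, ∃ w ∈ F, γ u w ∧ γ' w u}.ncard

end Erm

/-- The reference monotone path order
`γ_0 : e_1 ≺ e_2 ≺ ⋯ ≺ e_{r−1} ≺ a_1 ≺ ⋯ ≺ a_m ≺ e_r`, given by a rank function. -/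
def gamma0 (r m : ℕ) : Fin r ⊕ Fin m → Fin r ⊕ Fin m → Prop :=
  fun u w =>
    Sum.elim (fun j : Fin r => if (j : ℕ) < r - 1 then (j : ℕ) else r - 1 + m)
      (fun i : Fin m => r - 1 + (i : ℕ)) u <
    Sum.elim (fun j : Fin r => if (j : ℕ) < r - 1 then (j : ℕ) else r - 1 + m)
      (fun i : Fin m => r - 1 + (i : ℕ)) w

theorem isStrictTotalOrder_comap {α β : Type*} (ρ : α → α → Prop) [IsStrictTotalOrder α ρ]
    (f : β → α) (hf : Function.Injective f) :
    IsStrictTotalOrder β fun a b => ρ (f a) (f b) :=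
  { trichotomous := fun a b h h' => hf (Std.Trichotomous.trichotomous (f a) (f b) h h')
    irrefl := fun a => irrefl (f a)
    trans := fun _ _ _ => _root_.trans }

section Insertion

open scoped Classical

variable {α : Type*} [Fintype α]

/-- The number of predecessors of `a` with respect to `ρ`. -/
noncomputable def predCount (ρ : α → α → Prop) (a : α) : ℕ := #{b | ρ b a}

theorem predCount_lt_iff (ρ : α → α → Prop) [IsStrictTotalOrder α ρ] {a b : α} :
    predCount ρ a < predCount ρ b ↔ ρ a b := by
  have key : ∀ {a b}, ρ a b → predCount ρ a < predCount ρ b := fun {a b} h => by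
    refine Finset.card_lt_card ⟨fun c hc => ?_, fun hs => ?_⟩
    · simp only [mem_filter_univ] at hc ⊢
      exact _root_.trans hc h
    · have : a ∈ ({c | ρ c a} : Finset α) := hs (by simpa using h)
      exact irrefl a (by simpa using this)
  refine ⟨fun h => ?_, key⟩
  rcases trichotomous_of ρ a b with h' | rfl | h'
  · exact h'
  · exact absurd h (lt_irrefl _)
  · exact absurd (key h') h.not_gt

theorem predCount_lt_card (ρ : α → α → Prop) [IsStrictTotalOrder α ρ] (a : α) :
    predCount ρ a < Fintype.card α :=
  Finset.card_lt_univ_of_notMem (x := a) (by simpa using irrefl a)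

theorem predCount_injective (ρ : α → α → Prop) [IsStrictTotalOrder α ρ] :
    Function.Injective (predCount ρ) := fun a b h => by
  rcases trichotomous_of ρ a b with h' | h' | h'
  · exact absurd h ((predCount_lt_iff ρ).2 h').ne
  · exact h'
  · exact absurd h ((predCount_lt_iff ρ).2 h').ne'

theorem image_predCount (ρ : α → α → Prop) [IsStrictTotalOrder α ρ] :
    univ.image (predCount ρ) = range (Fintype.card α) := by
  refine Finset.eq_of_subset_of_card_le (fun x hx => ?_) ?_
  · obtain ⟨a, -, rfl⟩ := Finset.mem_image.1 hx
    exact Finset.mem_range.2 (predCount_lt_card ρ a)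
  · rw [Finset.card_image_of_injective _ (predCount_injective ρ)]
    simp

theorem card_predCount_lt (ρ : α → α → Prop) [IsStrictTotalOrder α ρ] {k : ℕ}
    (hk : k ≤ Fintype.card α) : #{a | predCount ρ a < k} = k := by
  rw [← Finset.card_image_of_injective _ (predCount_injective ρ)]
  have : image (predCount ρ) {a | predCount ρ a < k} = range k := by
    ext x
    simp only [Finset.mem_image, mem_filter_univ, Finset.mem_range]
    refine ⟨by rintro ⟨a, h, rfl⟩; exact h, fun hx => ?_⟩
    have : x ∈ univ.image (predCount ρ) := by
      rw [image_predCount]; exact Finset.mem_range.2 (hx.trans_le hk)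
    obtain ⟨a, -, rfl⟩ := Finset.mem_image.1 this
    exact ⟨a, hx, rfl⟩
  rw [this, Finset.card_range]

/-- A down-closed set of a strict total order consists of the elements of smallest rank. -/
theorem mem_iff_predCount_lt (ρ : α → α → Prop) [IsStrictTotalOrder α ρ] (D : α → Prop)
    (hD : ∀ a b, ρ a b → D b → D a) (a : α) : D a ↔ predCount ρ a < #{b | D b} := by
  constructor
  · intro ha
    refine Finset.card_lt_card ⟨fun c hc => ?_, fun hs => ?_⟩
    · simp only [mem_filter_univ] at hc ⊢
      exact hD _ _ hc ha
    · have : a ∈ ({c | ρ c a} : Finset α) := hs (by simpa using ha)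
      exact irrefl a (by simpa using this)
  · intro h
    by_contra ha
    refine h.not_ge (Finset.card_le_card fun c hc => ?_)
    simp only [mem_filter_univ] at hc ⊢
    rcases trichotomous_of ρ c a with h' | rfl | h'
    · exact h'
    · exact absurd hc ha
    · exact absurd (hD _ _ h' hc) ha

theorem isStrictTotalOrder_of_key {β : Type*} (f : β → ℕ) (hf : Function.Injective f) :
    IsStrictTotalOrder β fun a b => f a < f b :=
  { trichotomous := fun _ _ h h' => hf (le_antisymm (not_lt.1 h') (not_lt.1 h))
    irrefl := fun _ => lt_irrefl _
    trans := fun _ _ _ => lt_trans }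

end Insertion

section Codes

open scoped Classical

variable {C : Type*} {p : ℕ}

/-- The elements following `inl i` in the reference order on `Fin p ⊕ C`. -/
def After (i : Fin p) : Fin p ⊕ C → Prop := Sum.elim (fun j => i < j) (fun _ => True)

/-- The inclusion omitting the first of the elements `inl i`. -/
def tailEmb : Fin p ⊕ C → Fin (p + 1) ⊕ C := Sum.map Fin.succ id

theorem tailEmb_injective : Function.Injective (tailEmb : Fin p ⊕ C → _) :=
  Sum.map_injective.2 ⟨Fin.succ_injective _, Function.injective_id⟩

theorem eq_inl_zero_or_tailEmb (u : Fin (p + 1) ⊕ C) :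
    u = Sum.inl 0 ∨ ∃ a, u = tailEmb a := by
  rcases u with i | c
  · induction i using Fin.cases with
    | zero => exact Or.inl rfl
    | succ i => exact Or.inr ⟨Sum.inl i, rfl⟩
  · exact Or.inr ⟨Sum.inr c, rfl⟩

theorem after_zero_iff (u : Fin (p + 1) ⊕ C) : After 0 u ↔ ∃ a, u = tailEmb a := by
  rcases u with i | c
  · induction i using Fin.cases with
    | zero => simp [After, tailEmb, eq_comm]
    | succ i => exact iff_of_true (Fin.succ_pos i) ⟨Sum.inl i, rfl⟩
  · exact iff_of_true trivial ⟨Sum.inr c, rfl⟩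

variable [Fintype C]

/-- The inversion code of a relation: the number of elements that follow `inl i` in the
reference order but precede it in `ρ`. -/
noncomputable def code (ρ : Fin p ⊕ C → Fin p ⊕ C → Prop) (i : Fin p) : ℕ :=
  #{u : Fin p ⊕ C | After i u ∧ ρ u (Sum.inl i)}

/-- The strict total orders on `Fin p ⊕ C` extending the order `κ` on `C`. -/
noncomputable def extensions (κ : C → C → Prop) (p : ℕ) :
    Finset (Fin p ⊕ C → Fin p ⊕ C → Prop) :=
  {ρ | IsStrictTotalOrder _ ρ ∧ ∀ a b, ρ (Sum.inr a) (Sum.inr b) ↔ κ a b}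

theorem code_zero (ρ : Fin (p + 1) ⊕ C → Fin (p + 1) ⊕ C → Prop) :
    code ρ 0 = #{a | ρ (tailEmb a) (Sum.inl 0)} := by
  refine Eq.trans (congrArg Finset.card (Finset.ext fun u => ?_))
    (Finset.card_image_of_injective _ tailEmb_injective)
  simp only [mem_filter_univ, after_zero_iff, Finset.mem_image]
  constructor
  · rintro ⟨⟨a, rfl⟩, h⟩; exact ⟨a, h, rfl⟩
  · rintro ⟨a, h, rfl⟩; exact ⟨⟨a, rfl⟩, h⟩

theorem code_succ (ρ : Fin (p + 1) ⊕ C → Fin (p + 1) ⊕ C → Prop) (i : Fin p) :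
    code ρ i.succ = code (fun a b => ρ (tailEmb a) (tailEmb b)) i := by
  refine Eq.trans (congrArg Finset.card (Finset.ext fun u => ?_))
    (Finset.card_image_of_injective _ tailEmb_injective)
  simp only [mem_filter_univ, Finset.mem_image]
  constructor
  · rintro ⟨h, h'⟩
    rcases eq_inl_zero_or_tailEmb u with rfl | ⟨a, rfl⟩
    · simp [After] at h
    · refine ⟨a, ⟨?_, h'⟩, rfl⟩
      rcases a with a | a <;> simp_all [After, tailEmb]
  · rintro ⟨a, ⟨h, h'⟩, rfl⟩
    refine ⟨?_, h'⟩
    rcases a with a | a <;> simp_all [After, tailEmb]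

/-- The order obtained by inserting `inl 0` at position `k` of the order `ρ`. -/
noncomputable def insertKey (ρ : Fin p ⊕ C → Fin p ⊕ C → Prop) (k : ℕ) : Fin (p + 1) ⊕ C → ℕ :=
  Sum.elim (Fin.cases (2 * k) fun i => 2 * predCount ρ (Sum.inl i) + 1)
    fun c => 2 * predCount ρ (Sum.inr c) + 1

theorem insertKey_inl_zero (ρ : Fin p ⊕ C → Fin p ⊕ C → Prop) (k : ℕ) :
    insertKey ρ k (Sum.inl 0) = 2 * k := rfl

theorem insertKey_tailEmb (ρ : Fin p ⊕ C → Fin p ⊕ C → Prop) (k : ℕ) (a : Fin p ⊕ C) :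
    insertKey ρ k (tailEmb a) = 2 * predCount ρ a + 1 := by
  rcases a with a | a <;> rfl

theorem insertKey_injective (ρ : Fin p ⊕ C → Fin p ⊕ C → Prop) [IsStrictTotalOrder _ ρ] (k : ℕ) :
    Function.Injective (insertKey ρ k) := fun u w h => by
  rcases eq_inl_zero_or_tailEmb u with rfl | ⟨a, rfl⟩ <;>
  rcases eq_inl_zero_or_tailEmb w with rfl | ⟨b, rfl⟩ <;>
  simp only [insertKey_inl_zero, insertKey_tailEmb] at h
  · rfl
  · omega
  · omega
  · rw [predCount_injective ρ (show predCount ρ a = predCount ρ b by omega)]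

theorem insertKey_tailEmb_lt (ρ : Fin p ⊕ C → Fin p ⊕ C → Prop) [IsStrictTotalOrder _ ρ] (k : ℕ)
    (a b : Fin p ⊕ C) : insertKey ρ k (tailEmb a) < insertKey ρ k (tailEmb b) ↔ ρ a b := by
  rw [insertKey_tailEmb, insertKey_tailEmb, ← predCount_lt_iff ρ]
  omega

theorem code_zero_le (ρ : Fin (p + 1) ⊕ C → Fin (p + 1) ⊕ C → Prop) :
    code ρ 0 ≤ Fintype.card (Fin p ⊕ C) := by
  rw [code_zero]
  exact Finset.card_le_univ _

/-- An order is recovered by inserting `inl 0` into its restriction. -/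
theorem eq_insertKey (ρ : Fin (p + 1) ⊕ C → Fin (p + 1) ⊕ C → Prop) [IsStrictTotalOrder _ ρ]
    (u w : Fin (p + 1) ⊕ C) :
    ρ u w ↔ insertKey (fun a b => ρ (tailEmb a) (tailEmb b)) (code ρ 0) u
      < insertKey (fun a b => ρ (tailEmb a) (tailEmb b)) (code ρ 0) w := by
  have := isStrictTotalOrder_comap ρ (tailEmb (p := p) (C := C)) tailEmb_injective
  have key := mem_iff_predCount_lt (fun a b => ρ (tailEmb a) (tailEmb b))
    (fun a : Fin p ⊕ C => ρ (tailEmb a) (Sum.inl 0)) fun _ _ => _root_.trans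
  rw [← code_zero] at key
  rcases eq_inl_zero_or_tailEmb u with rfl | ⟨a, rfl⟩ <;>
  rcases eq_inl_zero_or_tailEmb w with rfl | ⟨b, rfl⟩
  · simpa using irrefl _
  · have h : ρ (Sum.inl 0) (tailEmb b) ↔ ¬ ρ (tailEmb b) (Sum.inl 0) := by
      refine ⟨fun h h' => irrefl _ (_root_.trans h h'), fun h => ?_⟩
      rcases trichotomous_of ρ (Sum.inl 0) (tailEmb b) with h' | h' | h'
      · exact h'
      · rcases b with b | b
        · exact absurd (Sum.inl_injective h').symm (Fin.succ_ne_zero b)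
        · cases h'
      · exact absurd h' h
    rw [h, key, insertKey_inl_zero, insertKey_tailEmb]
    omega
  · rw [key, insertKey_inl_zero, insertKey_tailEmb]
    omega
  · rw [insertKey_tailEmb_lt]

theorem mem_extensions {κ : C → C → Prop} {ρ : Fin p ⊕ C → Fin p ⊕ C → Prop} :
    ρ ∈ extensions κ p ↔
      IsStrictTotalOrder _ ρ ∧ ∀ a b, ρ (Sum.inr a) (Sum.inr b) ↔ κ a b := by
  simp [extensions]

/-- The entries of the inversion code of the orders extending `κ` vary independently. -/
theorem sum_extensions_prod_code {R : Type*} [CommSemiring R] (κ : C → C → Prop)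
    [IsStrictTotalOrder C κ] (p : ℕ) (g : Fin p → ℕ → R) :
    ∑ ρ ∈ extensions κ p, ∏ i, g i (code ρ i)
      = ∏ i : Fin p, ∑ k ∈ range (Fintype.card C + (p - i)), g i k := by
  induction p with
  | zero =>
    have : extensions κ 0
        = {fun u w => κ (u.elim Fin.elim0 id) (w.elim Fin.elim0 id)} := by
      ext ρ
      rw [mem_extensions, Finset.mem_singleton]
      constructor
      · rintro ⟨-, h⟩
        ext (u | u) (w | w)
        · exact u.elim0
        · exact u.elim0
        · exact w.elim0
        · exact h u w
      · rintro rfl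
        refine ⟨isStrictTotalOrder_comap κ _ ?_, fun a b => Iff.rfl⟩
        rintro (u | u) (w | w) h
        · exact u.elim0
        · exact u.elim0
        · exact w.elim0
        · exact congrArg Sum.inr h
    simp [this]
  | succ p ih =>
    rw [Fin.prod_univ_succ]
    have hcard : Fintype.card C + (p + 1 - ((0 : Fin (p + 1)) : ℕ))
        = Fintype.card (Fin p ⊕ C) + 1 := by simp; omega
    have hprod : ∏ i : Fin p, ∑ k ∈ range (Fintype.card C + (p + 1 - (i.succ : ℕ))), g i.succ k
        = ∏ i : Fin p, ∑ k ∈ range (Fintype.card C + (p - i)), g i.succ k := by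
      simp
    rw [hcard, hprod, ← ih fun i => g i.succ, Finset.sum_mul_sum, ← Finset.sum_product']
    refine Finset.sum_bij' (fun ρ _ => (code ρ 0, fun a b => ρ (tailEmb a) (tailEmb b)))
      (fun x _ => fun u w => insertKey x.2 x.1 u < insertKey x.2 x.1 w) ?_ ?_ ?_ ?_ ?_
    · intro ρ hρ
      obtain ⟨h1, h2⟩ := mem_extensions.1 hρ
      refine Finset.mem_product.2 ⟨Finset.mem_range_succ_iff.2 (code_zero_le ρ), ?_⟩
      exact mem_extensions.2 ⟨isStrictTotalOrder_comap ρ _ tailEmb_injective, h2⟩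
    · rintro ⟨k, ρ⟩ hx
      obtain ⟨h1, h2⟩ := mem_extensions.1 (Finset.mem_product.1 hx).2
      refine mem_extensions.2 ⟨isStrictTotalOrder_of_key _ (insertKey_injective ρ k),
        fun a b => ?_⟩
      rw [← h2]
      exact insertKey_tailEmb_lt ρ k (Sum.inr a) (Sum.inr b)
    · intro ρ hρ
      obtain ⟨h1, h2⟩ := mem_extensions.1 hρ
      ext u w
      exact (eq_insertKey ρ u w).symm
    · rintro ⟨k, ρ⟩ hx
      obtain ⟨h1, h2⟩ := mem_extensions.1 (Finset.mem_product.1 hx).2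
      have hk := Finset.mem_range_succ_iff.1 (Finset.mem_product.1 hx).1
      refine Prod.ext ?_ ?_
      · rw [code_zero]
        simp only [insertKey_inl_zero, insertKey_tailEmb]
        refine Eq.trans (congrArg Finset.card (Finset.ext fun a => ?_)) (card_predCount_lt ρ hk)
        simp only [mem_filter_univ]
        omega
      · ext a b
        exact insertKey_tailEmb_lt ρ k a b
    · intro ρ _
      simp [Fin.prod_univ_succ, code_succ]

end Codes

section Enumeration

open scoped Classical

variable {C : Type*} {p : ℕ}

theorem exists_forall_after_iff (ρ : Fin p ⊕ C → Fin p ⊕ C → Prop) [IsStrictTotalOrder _ ρ] :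
    (∃ i, ∀ c, ρ (Sum.inl i) (Sum.inr c)) ↔ ∃ i, ∀ u, After i u → ρ (Sum.inl i) u := by
  refine ⟨fun h => ?_, fun ⟨i, h⟩ => ⟨i, fun c => h _ trivial⟩⟩
  obtain ⟨i, hi, hmax⟩ := (Set.toFinite {i : Fin p | ∀ c, ρ (Sum.inl i) (Sum.inr c)}).exists_maximal
    h
  refine ⟨i, ?_⟩
  rintro (j | c) hu
  · have hj : ¬ ∀ c, ρ (Sum.inl j) (Sum.inr c) := fun hj =>
      absurd (hmax hj (le_of_lt hu)) (not_le.2 hu)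
    obtain ⟨c, hc⟩ := not_forall.1 hj
    rcases trichotomous_of ρ (Sum.inl j) (Sum.inr c) with h' | h' | h'
    · exact absurd h' hc
    · cases h'
    · exact _root_.trans (hi c) h'
  · exact hi c

variable [Fintype C]

theorem card_after (i : Fin p) :
    #{u : Fin p ⊕ C | After i u} + 1 = Fintype.card C + (p - i) := by
  have h : ({u : Fin p ⊕ C | After i u} : Finset _) = (Ioi i).disjSum univ := by
    ext (j | c) <;> rw [mem_filter_univ] <;> simp [After]
  rw [h, Finset.card_disjSum, Fin.card_Ioi, Finset.card_univ]
  omega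

theorem code_eq_zero_iff (ρ : Fin p ⊕ C → Fin p ⊕ C → Prop) [IsStrictTotalOrder _ ρ]
    (i : Fin p) : code ρ i = 0 ↔ ∀ u, After i u → ρ (Sum.inl i) u := by
  rw [code, Finset.card_eq_zero, Finset.filter_eq_empty_iff]
  refine ⟨fun h u hu => ?_, fun h u _ hu => irrefl _ (_root_.trans hu.2 (h u hu.1))⟩
  rcases trichotomous_of ρ (Sum.inl i) u with h' | rfl | h'
  · exact h'
  · exact absurd hu (lt_irrefl i)
  · exact absurd ⟨hu, h'⟩ (h (mem_univ u))

theorem code_eq_max_iff (ρ : Fin p ⊕ C → Fin p ⊕ C → Prop) (i : Fin p) :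
    code ρ i + 1 = Fintype.card C + (p - i) ↔ ∀ u, After i u → ρ u (Sum.inl i) := by
  rw [← card_after, add_left_inj, code, ← Finset.filter_filter, Finset.card_filter_eq_iff]
  simp

theorem exists_front_iff (ρ : Fin p ⊕ C → Fin p ⊕ C → Prop) [IsStrictTotalOrder _ ρ] :
    (∃ i, ∀ c, ρ (Sum.inl i) (Sum.inr c)) ↔ ∃ i, code ρ i = 0 := by
  simp only [exists_forall_after_iff, code_eq_zero_iff]

theorem exists_back_iff (ρ : Fin p ⊕ C → Fin p ⊕ C → Prop) [IsStrictTotalOrder _ ρ] :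
    (∃ i, ∀ c, ρ (Sum.inr c) (Sum.inl i)) ↔
      ∃ i : Fin p, code ρ i + 1 = Fintype.card C + (p - i) := by
  simp only [code_eq_max_iff]
  exact exists_forall_after_iff (Function.swap ρ)

/-- The `q`-count of the orders some of whose code entries satisfy `P`. -/
theorem sum_filter_exists {R : Type*} [CommRing R] (q : R) (κ : C → C → Prop)
    [IsStrictTotalOrder C κ] (p : ℕ) (P : Fin p → ℕ → Prop)
    [∀ i k, Decidable (P i k)]
    [DecidablePred fun ρ : Fin p ⊕ C → Fin p ⊕ C → Prop => ∃ i, P i (code ρ i)] :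
    ∑ ρ ∈ extensions κ p with ∃ i, P i (code ρ i), q ^ ∑ i, code ρ i
      = ∏ i : Fin p, ∑ k ∈ range (Fintype.card C + (p - i)), q ^ k
        - ∏ i : Fin p, ∑ k ∈ range (Fintype.card C + (p - i)), if P i k then 0 else q ^ k := by
  rw [← sum_extensions_prod_code κ p fun _ k => q ^ k,
    ← sum_extensions_prod_code κ p fun i k => if P i k then 0 else q ^ k,
    ← Finset.sum_sub_distrib, Finset.sum_filter]
  refine Finset.sum_congr rfl fun ρ _ => ?_
  rw [Finset.prod_pow_eq_pow_sum]
  split_ifs with h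
  · obtain ⟨i, hi⟩ := h
    rw [Finset.prod_eq_zero (mem_univ i) (by rw [if_pos hi]), sub_zero]
  · push Not at h
    rw [Finset.prod_congr rfl fun i _ => if_neg (h i), Finset.prod_pow_eq_pow_sum, sub_self]

end Enumeration

section QNumbers

open Polynomial

/-- The `q`-number `1 + q + ⋯ + q^{k-1}`. -/
noncomputable def qnum (k : ℕ) : ℤ[X] := ∑ i ∈ range k, X ^ i

theorem qfact_succ (k : ℕ) : qfact (k + 1) = qfact k * qnum (k + 1) :=
  Finset.prod_range_succ _ _

theorem qnum_add (a b : ℕ) : qnum (a + b) = qnum a + X ^ a * qnum b := by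
  simp only [qnum, Finset.sum_range_add, Finset.mul_sum, pow_add]

theorem prod_qnum_mul_qfact (n p : ℕ) :
    (∏ i : Fin p, qnum (n + (p - i))) * qfact n = qfact (n + p) := by
  induction p with
  | zero => simp
  | succ p ih =>
    rw [Fin.prod_univ_succ]
    simp only [Fin.val_zero, Fin.val_succ, Nat.add_sub_add_right, Nat.sub_zero]
    rw [mul_assoc, ih, ← add_assoc, qfact_succ, mul_comm]

theorem sum_range_ite_zero (k : ℕ) :
    (∑ i ∈ range (k + 1), if i = 0 then (0 : ℤ[X]) else X ^ i) = X * qnum k := by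
  rw [Finset.sum_range_succ']
  simp [qnum, Finset.mul_sum, pow_succ']

theorem sum_range_ite_last (k : ℕ) :
    (∑ i ∈ range (k + 1), if i + 1 = k + 1 then (0 : ℤ[X]) else X ^ i) = qnum k := by
  rw [Finset.sum_range_succ, if_pos rfl, add_zero]
  refine Finset.sum_congr rfl fun i hi => if_neg ?_
  have := Finset.mem_range.1 hi
  omega

open scoped Classical in
/-- The `q`-count of the increasing class of orders. -/
theorem sum_front_mul_qfact (n p : ℕ) (κ : Fin (n + 1) → Fin (n + 1) → Prop)
    [IsStrictTotalOrder _ κ] :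
    (∑ ρ ∈ extensions κ (p + 1) with ∃ i, code ρ i = 0, (X : ℤ[X]) ^ ∑ i, code ρ i)
      * qfact (n + 1) = qnum (p + 1) * qfact (n + 1 + p) := by
  rw [sum_filter_exists X κ (p + 1) fun _ k => k = 0]
  have h : ∀ i : Fin (p + 1), Fintype.card (Fin (n + 1)) + (p + 1 - i) = n + (p + 1 - i) + 1 :=
    fun i => by rw [Fintype.card_fin]; omega
  simp only [h, sum_range_ite_zero, Finset.prod_mul_distrib]
  have e1 := prod_qnum_mul_qfact (n + 1) (p + 1)
  have e2 := prod_qnum_mul_qfact n (p + 1)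
  have e3 : ∀ i : Fin (p + 1), qnum (n + 1 + (p + 1 - i)) =
      ∑ k ∈ range (n + (p + 1 - i) + 1), X ^ k := fun i => by rw [qnum, add_right_comm]
  simp only [e3] at e1
  have e4 : qnum (n + 1 + (p + 1)) = qnum (p + 1) + X ^ (p + 1) * qnum (n + 1) := by
    rw [← qnum_add, add_comm]
  have e5 : qfact (n + 1 + (p + 1)) = qfact (n + 1 + p) * qnum (n + 1 + (p + 1)) := qfact_succ _
  rw [sub_mul, e1, e5, e4, qfact_succ n, Finset.prod_const, Finset.card_univ, Fintype.card_fin,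
    show n + 1 + p = n + (p + 1) by omega, ← e2]
  ring

open scoped Classical in
/-- The `q`-count of the decreasing class of orders. -/
theorem sum_back_mul_qfact (n p : ℕ) (κ : Fin (n + 1) → Fin (n + 1) → Prop)
    [IsStrictTotalOrder _ κ] :
    (∑ ρ ∈ extensions κ (p + 1) with
        ∃ i, code ρ i + 1 = Fintype.card (Fin (n + 1)) + (p + 1 - i),
      (X : ℤ[X]) ^ ∑ i, code ρ i)
      * qfact (n + 1) = X ^ (n + 1) * qnum (p + 1) * qfact (n + 1 + p) := by
  rw [sum_filter_exists X κ (p + 1) fun i k => k + 1 = Fintype.card (Fin (n + 1)) + (p + 1 - i)]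
  have h : ∀ i : Fin (p + 1), Fintype.card (Fin (n + 1)) + (p + 1 - i) = n + (p + 1 - i) + 1 :=
    fun i => by rw [Fintype.card_fin]; omega
  simp only [h, sum_range_ite_last]
  have e1 := prod_qnum_mul_qfact (n + 1) (p + 1)
  have e2 := prod_qnum_mul_qfact n (p + 1)
  have e3 : ∀ i : Fin (p + 1), qnum (n + 1 + (p + 1 - i)) =
      ∑ k ∈ range (n + (p + 1 - i) + 1), X ^ k := fun i => by rw [qnum, add_right_comm]
  simp only [e3] at e1
  have e5 : qfact (n + 1 + (p + 1)) = qfact (n + 1 + p) * qnum (n + 1 + (p + 1)) := qfact_succ _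
  rw [sub_mul, e1, e5, qnum_add (n + 1), qfact_succ n,
    show n + 1 + p = n + (p + 1) by omega, ← e2]
  ring

end QNumbers

section Separation

variable {p n : ℕ}

/-- The standard basis vectors `e_i`, `i < p`, of `ℝ^{p+1}`, followed by the vectors
`A_k (e_0 + ⋯ + e_{p-1}) + B_k e_p`. -/
noncomputable def planarExtension (A B : Fin n → ℝ) : Fin p ⊕ Fin n → Fin (p + 1) → ℝ :=
  Sum.elim (fun i => Pi.single i.castSucc 1)
    fun k => A k • (∑ i : Fin p, Pi.single i.castSucc 1) + B k • Pi.single (Fin.last p) 1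

theorem planarExtension_inr_castSucc (A B : Fin n → ℝ) (k : Fin n) (i : Fin p) :
    planarExtension A B (Sum.inr k) i.castSucc = A k := by
  simp [planarExtension, Pi.single_apply, Fin.castSucc_ne_last]

theorem planarExtension_inr_last (A B : Fin n → ℝ) (k : Fin n) :
    (planarExtension A B (Sum.inr k) : Fin (p + 1) → ℝ) (Fin.last p) = B k := by
  simp [planarExtension]

theorem map_planarExtension_inr (A B : Fin n → ℝ) (φ : (Fin (p + 1) → ℝ) →ₗ[ℝ] ℝ) (k : Fin n) :
    φ (planarExtension A B (Sum.inr k))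
      = A k * ∑ i, φ (planarExtension A B (Sum.inl i)) + B k * φ (Pi.single (Fin.last p) 1) := by
  simp [planarExtension]

theorem exists_functional (A B : Fin n → ℝ) (c : Fin p → ℝ) (d : ℝ) :
    ∃ φ : (Fin (p + 1) → ℝ) →ₗ[ℝ] ℝ, (∀ i, φ (planarExtension A B (Sum.inl i)) = c i) ∧
      ∀ k, φ (planarExtension A B (Sum.inr k)) = A k * ∑ i, c i + B k * d := by
  have h : ∀ i, (Fintype.linearCombination ℝ (Fin.snoc c d : Fin (p + 1) → ℝ)) (Pi.single i 1)
      = (Fin.snoc c d : Fin (p + 1) → ℝ) i := fun i => by simp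
  refine ⟨Fintype.linearCombination ℝ (Fin.snoc c d : Fin (p + 1) → ℝ), fun i => ?_, fun k => ?_⟩
  · simp [planarExtension, h]
  · rw [map_planarExtension_inr]
    simp [planarExtension, h]

/-- Each vector is separated from its predecessors and successors by a linear functional. -/
def Separated {ι V : Type*} [AddCommGroup V] [Module ℝ V] (w : ι → V) (ρ : ι → ι → Prop) : Prop :=
  ∀ u, ∃ φ : V →ₗ[ℝ] ℝ,
    φ (w u) = 0 ∧ (∀ x, ρ x u → φ (w x) < 0) ∧ (∀ x, ρ u x → 0 < φ (w x))

theorem Separated.swap {ι V : Type*} [AddCommGroup V] [Module ℝ V] {w : ι → V}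
    {ρ : ι → ι → Prop} (h : Separated w ρ) : Separated w (Function.swap ρ) := fun u => by
  obtain ⟨φ, h0, h1, h2⟩ := h u
  exact ⟨-φ, by simpa using h0, fun x hx => by simpa using h2 x hx,
    fun x hx => by simpa using h1 x hx⟩

/-- The elements `inr k` appear in increasing order and some `inl i` precedes all of them. -/
def IncreasingFront (ρ : Fin p ⊕ Fin n → Fin p ⊕ Fin n → Prop) : Prop :=
  (∀ k l, k < l → ρ (Sum.inr k) (Sum.inr l)) ∧ ∃ i, ∀ k, ρ (Sum.inl i) (Sum.inr k)

section Necessity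

variable {A B : Fin n → ℝ}

theorem local_increasing_of_sum_neg (hB : ∀ k, 0 < B k)
    (hdet : ∀ k l, k < l → A l * B k < A k * B l)
    (ρ : Fin p ⊕ Fin n → Fin p ⊕ Fin n → Prop) [IsStrictTotalOrder _ ρ]
    (k : Fin n) (φ : (Fin (p + 1) → ℝ) →ₗ[ℝ] ℝ)
    (h0 : φ (planarExtension A B (Sum.inr k)) = 0)
    (hneg : ∀ x, ρ x (Sum.inr k) → φ (planarExtension A B x) < 0)
    (hpos : ∀ x, ρ (Sum.inr k) x → 0 < φ (planarExtension A B x))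
    (hS : ∑ i : Fin p, φ (planarExtension A B (Sum.inl i)) < 0) :
    (∀ l, k < l → ρ (Sum.inr k) (Sum.inr l)) ∧ (∀ l, l < k → ρ (Sum.inr l) (Sum.inr k)) ∧
      ∃ i, ρ (Sum.inl i) (Sum.inr k) := by
  have hval : ∀ l, B k * φ (planarExtension A B (Sum.inr l)) =
      (A l * B k - A k * B l) * ∑ i : Fin p, φ (planarExtension A B (Sum.inl i)) := fun l => by
    rw [map_planarExtension_inr] at h0 ⊢
    linear_combination B l * h0
  have of_pos : ∀ x, 0 < φ (planarExtension A B x) → ρ (Sum.inr k) x := fun x hx => by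
    rcases trichotomous_of ρ (Sum.inr k) x with h | rfl | h
    · exact h
    · exact absurd h0 hx.ne'
    · exact absurd (hneg x h) hx.not_gt
  have of_neg : ∀ x, φ (planarExtension A B x) < 0 → ρ x (Sum.inr k) := fun x hx => by
    rcases trichotomous_of ρ x (Sum.inr k) with h | rfl | h
    · exact h
    · exact absurd h0 hx.ne
    · exact absurd (hpos x h) hx.not_gt
  refine ⟨fun l hl => of_pos _ ?_, fun l hl => of_neg _ ?_, ?_⟩
  · refine pos_of_mul_pos_right (a := B k) ?_ (hB k).le
    rw [hval]
    exact mul_pos_of_neg_of_neg (sub_neg.2 (hdet k l hl)) hS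
  · refine neg_of_mul_neg_right (a := B k) ?_ (hB k).le
    rw [hval]
    have := hdet l k hl
    exact mul_neg_of_pos_of_neg (by linarith) hS
  · by_contra! hi
    refine hS.not_ge (Finset.sum_nonneg fun i _ => ?_)
    by_contra! hlt
    exact hi i (of_neg _ hlt)

theorem local_monotone (hB : ∀ k, 0 < B k)
    (hdet : ∀ k l, k < l → A l * B k < A k * B l)
    (ρ : Fin p ⊕ Fin n → Fin p ⊕ Fin n → Prop) [IsStrictTotalOrder _ ρ]
    (hn : 2 ≤ n) (hsep : Separated (planarExtension A B) ρ) (k : Fin n) :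
    ((∀ l, k < l → ρ (Sum.inr k) (Sum.inr l)) ∧ (∀ l, l < k → ρ (Sum.inr l) (Sum.inr k)) ∧
      ∃ i, ρ (Sum.inl i) (Sum.inr k)) ∨
    ((∀ l, k < l → ρ (Sum.inr l) (Sum.inr k)) ∧ (∀ l, l < k → ρ (Sum.inr k) (Sum.inr l)) ∧
      ∃ i, ρ (Sum.inr k) (Sum.inl i)) := by
  obtain ⟨φ, h0, h1, h2⟩ := hsep (Sum.inr k)
  rcases lt_trichotomy (∑ i : Fin p, φ (planarExtension A B (Sum.inl i))) 0 with hS | hS | hS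
  · exact Or.inl (local_increasing_of_sum_neg hB hdet ρ k φ h0 h1 h2 hS)
  · have : Nontrivial (Fin n) := Fin.nontrivial_iff_two_le.2 hn
    obtain ⟨l, hl⟩ := exists_ne k
    have hd : φ (Pi.single (Fin.last p) 1) = 0 := by
      rw [map_planarExtension_inr, hS, mul_zero, zero_add] at h0
      exact (mul_eq_zero.1 h0).resolve_left (hB k).ne'
    have hl0 : φ (planarExtension A B (Sum.inr l)) = 0 := by
      rw [map_planarExtension_inr, hS, hd]; simp
    rcases trichotomous_of ρ (Sum.inr k) (Sum.inr l) with h | h | h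
    · exact absurd hl0 (h2 _ h).ne'
    · exact absurd (Sum.inr_injective h).symm hl
    · exact absurd hl0 (h1 _ h).ne
  · exact Or.inr (local_increasing_of_sum_neg hB hdet (Function.swap ρ) k (-φ) (by simpa using h0)
      (fun x hx => by simpa using h2 x hx) (fun x hx => by simpa using h1 x hx)
      (by simpa using hS))

theorem increasingFront_of_first (hB : ∀ k, 0 < B k)
    (hdet : ∀ k l, k < l → A l * B k < A k * B l)
    (ρ : Fin p ⊕ Fin n → Fin p ⊕ Fin n → Prop) [IsStrictTotalOrder _ ρ]
    (hn : 2 ≤ n) (hsep : Separated (planarExtension A B) ρ)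
    (k₀ : Fin n) (hk₀ : ∀ k, k ≠ k₀ → k₀ < k)
    (h : ∀ l, k₀ < l → ρ (Sum.inr k₀) (Sum.inr l)) (hi : ∃ i, ρ (Sum.inl i) (Sum.inr k₀)) :
    IncreasingFront ρ := by
  refine ⟨fun k l hkl => ?_, ?_⟩
  · by_cases hk : k = k₀
    · subst hk; exact h l hkl
    · rcases local_monotone hB hdet ρ hn hsep k with h' | h'
      · exact h'.1 l hkl
      · exact absurd (h k (hk₀ k hk)) (asymm (h'.2.1 k₀ (hk₀ k hk)))
  · obtain ⟨i, hi⟩ := hi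
    refine ⟨i, fun k => ?_⟩
    by_cases hk : k = k₀
    · subst hk; exact hi
    · exact _root_.trans hi (h k (hk₀ k hk))

theorem increasingFront_of_separated (hB : ∀ k, 0 < B k)
    (hdet : ∀ k l, k < l → A l * B k < A k * B l)
    (ρ : Fin p ⊕ Fin n → Fin p ⊕ Fin n → Prop) [IsStrictTotalOrder _ ρ]
    (hn : 2 ≤ n) (hsep : Separated (planarExtension A B) ρ) :
    IncreasingFront ρ ∨ IncreasingFront (Function.swap ρ) := by
  have hk₀ : ∀ k : Fin n, k ≠ ⟨0, by omega⟩ → ⟨0, by omega⟩ < k := fun k hk =>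
    Fin.lt_def.2 (Nat.pos_of_ne_zero fun h => hk (Fin.ext h))
  rcases local_monotone hB hdet ρ hn hsep ⟨0, by omega⟩ with h | h
  · exact Or.inl (increasingFront_of_first hB hdet ρ hn hsep _ hk₀ h.1 h.2.2)
  · exact Or.inr (increasingFront_of_first hB hdet (Function.swap ρ) hn hsep.swap _ hk₀ h.1 h.2.2)

end Necessity

/-- A sign vector with a negative entry is realized by a vector of any given negative sum. -/
theorem exists_sum_eq_of_neg {ι : Type*} [Fintype ι] (s : ι → ℝ) {i₀ : ι} (hi₀ : s i₀ < 0)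
    {S : ℝ} (hS : S < 0) :
    ∃ c : ι → ℝ, (∀ i, s i < 0 → c i < 0) ∧ (∀ i, s i = 0 → c i = 0) ∧ (∀ i, 0 < s i → 0 < c i) ∧
      ∑ i, c i = S := by
  classical
  set T := ∑ i ∈ univ \ {i₀}, s i
  set ε := -S / (|T| + 1)
  have hε : 0 < ε := div_pos (neg_pos.2 hS) (by positivity)
  have hεT : S < ε * T := by
    have h1 : ε * (|T| + 1) = -S := div_mul_cancel₀ _ (by positivity)
    nlinarith [neg_abs_le T]
  refine ⟨Function.update (fun i => ε * s i) i₀ (S - ε * T), fun i hi => ?_, fun i hi => ?_,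
    fun i hi => ?_, ?_⟩
  · by_cases h : i = i₀
    · subst h; simpa using hεT
    · simpa [h] using mul_neg_of_pos_of_neg hε hi
  · have h : i ≠ i₀ := by rintro rfl; exact hi₀.ne hi
    simp [h, hi]
  · have h : i ≠ i₀ := by rintro rfl; exact hi₀.not_gt hi
    simpa [h] using mul_pos hε hi
  · rw [Finset.sum_update_of_mem (mem_univ i₀), ← Finset.mul_sum]
    ring

section Sufficiency

open scoped Classical

variable {A B : Fin n → ℝ} (ρ : Fin p ⊕ Fin n → Fin p ⊕ Fin n → Prop) [IsStrictTotalOrder _ ρ]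

/-- The sign of `inl i` relative to `u`. -/
noncomputable def relSign (u : Fin p ⊕ Fin n) (i : Fin p) : ℝ :=
  if ρ (Sum.inl i) u then -1 else if ρ u (Sum.inl i) then 1 else 0

theorem exists_separating (u : Fin p ⊕ Fin n) (c : Fin p → ℝ) (d : ℝ)
    (hneg : ∀ i, relSign ρ u i < 0 → c i < 0) (hzero : ∀ i, relSign ρ u i = 0 → c i = 0)
    (hpos : ∀ i, 0 < relSign ρ u i → 0 < c i)
    (h0 : ∀ k, u = Sum.inr k → A k * ∑ i, c i + B k * d = 0)
    (h1 : ∀ k, ρ (Sum.inr k) u → A k * ∑ i, c i + B k * d < 0)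
    (h2 : ∀ k, ρ u (Sum.inr k) → 0 < A k * ∑ i, c i + B k * d) :
    ∃ φ : (Fin (p + 1) → ℝ) →ₗ[ℝ] ℝ, φ (planarExtension A B u) = 0 ∧
      (∀ x, ρ x u → φ (planarExtension A B x) < 0) ∧
      (∀ x, ρ u x → 0 < φ (planarExtension A B x)) := by
  obtain ⟨φ, hl, hr⟩ := exists_functional A B c d
  refine ⟨φ, ?_, ?_, ?_⟩
  · rcases u with i | k
    · rw [hl]; exact hzero i (by simp [relSign, irrefl])
    · rw [hr]; exact h0 k rfl
  · rintro (i | k) hx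
    · rw [hl]; exact hneg i (by simp [relSign, hx])
    · rw [hr]; exact h1 k hx
  · rintro (i | k) hx
    · rw [hl]; exact hpos i (by simp [relSign, hx, asymm hx])
    · rw [hr]; exact h2 k hx

theorem exists_separating_of_neg (u : Fin p ⊕ Fin n) {i₀ : Fin p} (hi₀ : ρ (Sum.inl i₀) u)
    {S : ℝ} (hS : S < 0) (d : ℝ) (h0 : ∀ k, u = Sum.inr k → A k * S + B k * d = 0)
    (h1 : ∀ k, ρ (Sum.inr k) u → A k * S + B k * d < 0)
    (h2 : ∀ k, ρ u (Sum.inr k) → 0 < A k * S + B k * d) :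
    ∃ φ : (Fin (p + 1) → ℝ) →ₗ[ℝ] ℝ, φ (planarExtension A B u) = 0 ∧
      (∀ x, ρ x u → φ (planarExtension A B x) < 0) ∧
      (∀ x, ρ u x → 0 < φ (planarExtension A B x)) := by
  obtain ⟨c, hn, hz, hp, rfl⟩ := exists_sum_eq_of_neg (relSign ρ u) (i₀ := i₀)
    (by simp [relSign, hi₀]) hS
  exact exists_separating ρ u c d hn hz hp h0 h1 h2

theorem IncreasingFront.separated (hA : ∀ k, 0 ≤ A k) (hB : ∀ k, 0 < B k)
    (hAB : ∀ k, A k ≤ B k) (hdet : ∀ k l, k < l → A l * B k < A k * B l)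
    (hρ : IncreasingFront ρ) : Separated (planarExtension A B) ρ := by
  obtain ⟨hinc, i₀, hi₀⟩ := hρ
  have hlt : ∀ k l, ρ (Sum.inr k) (Sum.inr l) → k < l := fun k l h => by
    rcases lt_trichotomy k l with h' | rfl | h'
    · exact h'
    · exact absurd h (irrefl _)
    · exact absurd h (asymm (hinc _ _ h'))
  rintro (j | k)
  · by_cases hne : ∃ k, ρ (Sum.inr k) (Sum.inl j)
    · have hi₀j : ρ (Sum.inl i₀) (Sum.inl j) := by
        obtain ⟨k, hk⟩ := hne
        exact _root_.trans (hi₀ k) hk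
      obtain ⟨t, ht, htmax⟩ :=
        (Set.toFinite {k : Fin n | ρ (Sum.inr k) (Sum.inl j)}).exists_maximal hne
      by_cases hall : ∃ k, ρ (Sum.inl j) (Sum.inr k)
      · obtain ⟨t', ht', htmin⟩ :=
          (Set.toFinite {k : Fin n | ρ (Sum.inl j) (Sum.inr k)}).exists_minimal hall
        refine exists_separating_of_neg ρ _ hi₀j (S := -(B t + B t')) ?_ (A t + A t')
          (fun k h => by cases h) (fun k hk => ?_) (fun k hk => ?_)
        · have := hB t; have := hB t'; linarith
        · have h1 := hdet k t' (hlt _ _ (_root_.trans hk ht'))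
          have h2 : k = t ∨ k < t :=
            ((le_total k t).elim id (htmax hk)).eq_or_lt
          rcases h2 with rfl | h2
          · linarith
          · have := hdet _ _ h2; linarith
        · have h1 := hdet t k (hlt _ _ (_root_.trans ht hk))
          have h2 : t' = k ∨ t' < k :=
            ((le_total t' k).elim id (htmin hk)).eq_or_lt
          rcases h2 with rfl | h2
          · linarith
          · have := hdet _ _ h2; linarith
      · refine exists_separating_of_neg ρ _ hi₀j (S := -1) (by norm_num) (-1)
          (fun k h => by cases h) (fun k hk => ?_) (fun k hk => absurd ⟨k, hk⟩ hall)
        have := hA k; have := hB k; linarith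
    · refine exists_separating ρ _ (relSign ρ (Sum.inl j)) (|∑ i, relSign ρ (Sum.inl j) i| + 1)
        (fun _ => id) (fun _ => id) (fun _ => id) (fun k h => by cases h)
        (fun k hk => absurd ⟨k, hk⟩ hne) (fun k _ => ?_)
      set S := ∑ i, relSign ρ (Sum.inl j) i
      have h1 : A k * |S| ≤ B k * |S| := mul_le_mul_of_nonneg_right (hAB k) (abs_nonneg S)
      have h2 : A k * -|S| ≤ A k * S := mul_le_mul_of_nonneg_left (neg_abs_le S) (hA k)
      have := hB k
      linarith
  · refine exists_separating_of_neg ρ _ (hi₀ k) (S := -B k) (neg_neg_iff_pos.2 (hB k)) (A k) ?_ ?_ ?_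
    · rintro l h
      cases h
      ring
    · intro l hl
      have := hdet _ _ (hlt _ _ hl)
      linarith
    · intro l hl
      have := hdet _ _ (hlt _ _ hl)
      linarith

end Sufficiency

theorem separated_planarExtension_iff {A B : Fin n → ℝ} (hn : 2 ≤ n) (hA : ∀ k, 0 ≤ A k)
    (hB : ∀ k, 0 < B k) (hAB : ∀ k, A k ≤ B k) (hdet : ∀ k l, k < l → A l * B k < A k * B l)
    (ρ : Fin p ⊕ Fin n → Fin p ⊕ Fin n → Prop) [IsStrictTotalOrder _ ρ] :
    Separated (planarExtension A B) ρ ↔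
      IncreasingFront ρ ∨ IncreasingFront (Function.swap ρ) :=
  ⟨increasingFront_of_separated hB hdet ρ hn, fun h => h.elim
    (fun h => h.separated ρ hA hB hAB hdet)
    fun h => (h.separated (Function.swap ρ) hA hB hAB hdet).swap⟩

end Separation

section Flats

/-- The indices of the vectors in the span of two given ones. -/
def lineThrough {ι V : Type*} [AddCommGroup V] [Module ℝ V] (w : ι → V) (a b : ι) : Set ι :=
  {z | w z ∈ Submodule.span ℝ {w a, w b}}

/-- `IsRank2Flat` for an arbitrary index type and ambient space. -/
def IsLine {ι V : Type*} [AddCommGroup V] [Module ℝ V] (w : ι → V) (F : Set ι) : Prop :=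
  Module.finrank ℝ (Submodule.span ℝ (w '' F)) = 2 ∧ ∀ u, w u ∈ Submodule.span ℝ (w '' F) → u ∈ F

theorem LinearIndependent.finrank_span_two {V : Type*} [AddCommGroup V] [Module ℝ V] {x y : V}
    (h : LinearIndependent ℝ ![x, y]) : Module.finrank ℝ (Submodule.span ℝ {x, y}) = 2 := by
  have := finrank_span_eq_card h
  rwa [Matrix.range_cons_cons_empty, Fintype.card_fin] at this

theorem setOf_isLine_inverted {ι V : Type*} [AddCommGroup V] [Module ℝ V]
    [FiniteDimensional ℝ V] (w : ι → V) (R γ : ι → ι → Prop)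
    (hR : ∀ a b, R a b → LinearIndependent ℝ ![w a, w b]) :
    {F | IsLine w F ∧ ∃ a ∈ F, ∃ b ∈ F, R a b ∧ γ b a}
      = {F | ∃ a b, R a b ∧ γ b a ∧ F = lineThrough w a b} := by
  ext F
  constructor
  · rintro ⟨⟨hF, hcl⟩, a, ha, b, hb, hab, hba⟩
    refine ⟨a, b, hab, hba, ?_⟩
    have hle : Submodule.span ℝ {w a, w b} ≤ Submodule.span ℝ (w '' F) := by
      refine Submodule.span_mono ?_
      rintro _ (rfl | rfl)
      exacts [⟨a, ha, rfl⟩, ⟨b, hb, rfl⟩]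
    have heq := Submodule.eq_of_le_of_finrank_eq hle (by rw [(hR a b hab).finrank_span_two, hF])
    ext z
    rw [lineThrough, Set.mem_ofPred_eq, heq]
    exact ⟨fun hz => Submodule.subset_span ⟨z, hz, rfl⟩, hcl z⟩
  · rintro ⟨a, b, hab, hba, rfl⟩
    have ha : a ∈ lineThrough w a b := Submodule.subset_span (Or.inl rfl)
    have hb : b ∈ lineThrough w a b := Submodule.subset_span (Or.inr rfl)
    have heq : Submodule.span ℝ (w '' lineThrough w a b) = Submodule.span ℝ {w a, w b} := by
      refine le_antisymm (Submodule.span_le.2 ?_) (Submodule.span_mono ?_)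
      · rintro _ ⟨z, hz, rfl⟩
        exact hz
      · rintro _ (rfl | rfl)
        exacts [⟨a, ha, rfl⟩, ⟨b, hb, rfl⟩]
    refine ⟨⟨?_, fun u hu => ?_⟩, a, ha, b, hb, hab, hba⟩
    · rw [heq, (hR a b hab).finrank_span_two]
    · rw [heq] at hu
      exact hu

variable {p n : ℕ} {A B : Fin n → ℝ}

theorem planarExtension_inl_castSucc (i j : Fin p) :
    planarExtension A B (Sum.inl i) j.castSucc = if j = i then 1 else 0 := by
  simp [planarExtension, Pi.single_apply]

theorem planarExtension_inl_last (i : Fin p) :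
    planarExtension A B (Sum.inl i) (Fin.last p) = 0 := by
  simp [planarExtension]

theorem linearIndependent_planarExtension (hp : 2 ≤ p) (hB : ∀ k, 0 < B k)
    (hdet : ∀ k l, k < l → A l * B k < A k * B l) (a b : Fin p ⊕ Fin n)
    (hab : Sum.Lex (· < ·) (· < ·) a b) :
    LinearIndependent ℝ ![planarExtension A B a, planarExtension A B b] := by
  rw [LinearIndependent.pair_iff]
  intro s t h
  have hc := fun j : Fin p => congrFun h j.castSucc
  have hl := congrFun h (Fin.last p)
  simp only [Pi.add_apply, Pi.smul_apply, smul_eq_mul, Pi.zero_apply] at hc hl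
  rcases hab with @⟨i, j, hij⟩ | @⟨k, l, hkl⟩ | @⟨i, k⟩
  · simp only [planarExtension_inl_castSucc] at hc
    have h1 := hc i
    have h2 := hc j
    simp only [if_true, hij.ne, hij.ne', if_false] at h1 h2
    constructor <;> linarith
  · simp only [planarExtension_inr_castSucc, planarExtension_inr_last] at hc hl
    have h1 := hc ⟨0, by omega⟩
    have hD : A k * B l - A l * B k ≠ 0 := (sub_pos.2 (hdet k l hkl)).ne'
    constructor
    · refine (mul_eq_zero.1 ?_).resolve_right hD
      linear_combination B l * h1 - A l * hl
    · refine (mul_eq_zero.1 ?_).resolve_right hD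
      linear_combination A k * hl - B k * h1
  · simp only [planarExtension_inl_castSucc, planarExtension_inl_last,
      planarExtension_inr_castSucc, planarExtension_inr_last] at hc hl
    have ht : t = 0 := by
      rw [mul_zero, zero_add] at hl
      exact (mul_eq_zero.1 hl).resolve_right (hB k).ne'
    have h1 := hc i
    rw [if_pos rfl, ht] at h1
    exact ⟨by linarith, ht⟩

theorem lineThrough_inl (hp : 2 ≤ p) (hB : ∀ k, 0 < B k)
    (hdet : ∀ k l, k < l → A l * B k < A k * B l) (i : Fin p) (b : Fin p ⊕ Fin n) :
    lineThrough (planarExtension A B) (Sum.inl i) b = {Sum.inl i, b} := by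
  have : Nontrivial (Fin p) := Fin.nontrivial_iff_two_le.2 hp
  ext z
  constructor
  swap
  · rintro (rfl | rfl)
    exacts [Submodule.subset_span (Or.inl rfl), Submodule.subset_span (Or.inr rfl)]
  intro hz
  obtain ⟨s, t, h⟩ := Submodule.mem_span_pair.1 hz
  have hc := fun j : Fin p => congrFun h j.castSucc
  have hl := congrFun h (Fin.last p)
  simp only [Pi.add_apply, Pi.smul_apply, smul_eq_mul] at hc hl
  rw [Set.mem_insert_iff, Set.mem_singleton_iff]
  rcases b with j | k <;> rcases z with x | x
  · by_contra! hne
    have h1 : x ≠ i := fun h => hne.1 (congrArg _ h)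
    have h2 : x ≠ j := fun h => hne.2 (congrArg _ h)
    have h3 := hc x
    simp [planarExtension_inl_castSucc, h1, h2] at h3
  · simp only [planarExtension_inl_last, planarExtension_inr_last] at hl
    exact absurd (by linarith) (hB x).ne'
  · by_contra! hne
    have h1 : x ≠ i := fun h => hne.1 (congrArg _ h)
    simp only [planarExtension_inl_last, planarExtension_inr_last] at hl
    have ht : t = 0 := by
      rw [mul_zero, zero_add] at hl
      exact (mul_eq_zero.1 hl).resolve_right (hB k).ne'
    have h3 := hc x
    simp [planarExtension_inl_castSucc, h1, ht] at h3
  · by_contra! hne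
    have h1 : x ≠ k := fun h => hne.2 (congrArg _ h)
    obtain ⟨j, hj⟩ := exists_ne i
    have h2 := hc j
    simp only [planarExtension_inl_last, planarExtension_inl_castSucc, hj, if_false,
      planarExtension_inr_castSucc, planarExtension_inr_last] at hl h2
    have h3 : A x * B k = A k * B x := by linear_combination A k * hl - B k * h2
    rcases h1.lt_or_gt with h | h
    · exact (hdet _ _ h).ne' h3
    · exact (hdet _ _ h).ne h3

theorem lineThrough_inr (hp : 2 ≤ p) (hdet : ∀ k l, k < l → A l * B k < A k * B l)
    {k l : Fin n} (hkl : k < l) :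
    lineThrough (planarExtension A B : Fin p ⊕ Fin n → _) (Sum.inr k) (Sum.inr l)
      = Set.range Sum.inr := by
  have : Nontrivial (Fin p) := Fin.nontrivial_iff_two_le.2 hp
  have hD : A k * B l - A l * B k ≠ 0 := (sub_pos.2 (hdet k l hkl)).ne'
  ext z
  rw [lineThrough, Set.mem_ofPred_eq, Submodule.mem_span_pair]
  rcases z with i | x
  · refine iff_of_false ?_ (by simp)
    rintro ⟨s, t, h⟩
    have hc := fun j : Fin p => congrFun h j.castSucc
    obtain ⟨j, hj⟩ := exists_ne i
    have h1 := hc i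
    have h2 := hc j
    simp only [Pi.add_apply, Pi.smul_apply, smul_eq_mul, planarExtension_inr_castSucc,
      planarExtension_inl_castSucc, if_true, hj, if_false] at h1 h2
    linarith
  · refine iff_of_true ⟨(A x * B l - A l * B x) / (A k * B l - A l * B k),
      (A k * B x - A x * B k) / (A k * B l - A l * B k), ?_⟩ ⟨x, rfl⟩
    ext j
    induction j using Fin.lastCases with
    | last =>
      simp only [Pi.add_apply, Pi.smul_apply, smul_eq_mul, planarExtension_inr_last]
      rw [div_mul_eq_mul_div, div_mul_eq_mul_div, ← add_div, div_eq_iff hD]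
      ring
    | cast j =>
      simp only [Pi.add_apply, Pi.smul_apply, smul_eq_mul, planarExtension_inr_castSucc]
      rw [div_mul_eq_mul_div, div_mul_eq_mul_div, ← add_div, div_eq_iff hD]
      ring

open scoped Classical in
theorem ncard_pairs (ρ : Fin p ⊕ Fin n → Fin p ⊕ Fin n → Prop) :
    {F : Set (Fin p ⊕ Fin n) | ∃ i u, After i u ∧ ρ u (Sum.inl i) ∧ F = {Sum.inl i, u}}.ncard
      = ∑ i, code ρ i := by
  set P : Finset (Σ _ : Fin p, Fin p ⊕ Fin n) :=
    univ.sigma fun i => {u | After i u ∧ ρ u (Sum.inl i)}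
  have himg : {F : Set (Fin p ⊕ Fin n) | ∃ i u, After i u ∧ ρ u (Sum.inl i) ∧ F = {Sum.inl i, u}}
      = (fun x : Σ _ : Fin p, Fin p ⊕ Fin n => ({Sum.inl x.1, x.2} : Set _)) '' P := by
    ext F
    constructor
    · rintro ⟨i, u, h1, h2, rfl⟩
      exact ⟨⟨i, u⟩, by simp [P, h1, h2], rfl⟩
    · rintro ⟨⟨i, u⟩, h, rfl⟩
      have : After i u ∧ ρ u (Sum.inl i) := by simpa [P] using h
      exact ⟨i, u, this.1, this.2, rfl⟩
  rw [himg, Set.InjOn.ncard_image, Set.ncard_coe_finset, Finset.card_sigma]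
  · rfl
  · rintro ⟨i, u⟩ hi ⟨j, w⟩ hj h
    have hi' : After i u := by
      have : After i u ∧ ρ u (Sum.inl i) := by simpa [P] using hi
      exact this.1
    have hj' : After j w := by
      have : After j w ∧ ρ w (Sum.inl j) := by simpa [P] using hj
      exact this.1
    rcases Set.pair_eq_pair_iff.1 h with ⟨h1, h2⟩ | ⟨h1, h2⟩
    · cases h1
      cases (show u = w from h2)
      rfl
    · rw [show u = Sum.inl j from h2] at hi'
      rw [← show Sum.inl i = w from h1] at hj'
      exact absurd hi' (lt_asymm (show j < i from hj'))

theorem after_iff_lex (i : Fin p) (u : Fin p ⊕ Fin n) :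
    After i u ↔ Sum.Lex (· < ·) (· < ·) (Sum.inl i) u := by
  rcases u with u | u <;> simp [After]

open scoped Classical in
/-- The number of inverted rank-2 flats in terms of the inversion code. -/
theorem ncard_inverted (hp : 2 ≤ p) (hB : ∀ k, 0 < B k)
    (hdet : ∀ k l, k < l → A l * B k < A k * B l) (ρ : Fin p ⊕ Fin n → Fin p ⊕ Fin n → Prop) :
    {F | IsLine (planarExtension A B) F ∧
      ∃ a ∈ F, ∃ b ∈ F, Sum.Lex (· < ·) (· < ·) a b ∧ ρ b a}.ncard
      = ∑ i, code ρ i + if ∃ k l, k < l ∧ ρ (Sum.inr l) (Sum.inr k) then 1 else 0 := by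
  rw [setOf_isLine_inverted _ _ _ (linearIndependent_planarExtension hp hB hdet), ← ncard_pairs]
  split_ifs with h
  · obtain ⟨k, l, hkl, hlk⟩ := h
    rw [← Set.ncard_insert_of_notMem (a := Set.range Sum.inr) _ (Set.toFinite _)]
    · congr 1
      ext F
      constructor
      · rintro ⟨a, b, hab, hba, rfl⟩
        rcases a with i | k'
        · exact Or.inr ⟨i, b, (after_iff_lex i b).2 hab, hba, lineThrough_inl hp hB hdet i b⟩
        · rcases b with b | l'
          · cases hab
          · exact Or.inl (lineThrough_inr hp hdet (Sum.lex_inr_inr.1 hab))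
      · rintro (rfl | ⟨i, u, h1, h2, rfl⟩)
        · exact ⟨_, _, Sum.Lex.inr hkl, hlk, (lineThrough_inr hp hdet hkl).symm⟩
        · exact ⟨_, _, (after_iff_lex i u).1 h1, h2, (lineThrough_inl hp hB hdet i u).symm⟩
    · rintro ⟨i, u, -, -, h⟩
      have : (Sum.inl i : Fin p ⊕ Fin n) ∈ Set.range (Sum.inr : Fin n → Fin p ⊕ Fin n) := by
        rw [h]; exact Or.inl rfl
      simp at this
  · rw [add_zero]
    congr 1
    ext F
    constructor
    · rintro ⟨a, b, hab, hba, rfl⟩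
      rcases a with i | k'
      · exact ⟨i, b, (after_iff_lex i b).2 hab, hba, lineThrough_inl hp hB hdet i b⟩
      · rcases b with b | l'
        · cases hab
        · exact absurd ⟨k', l', Sum.lex_inr_inr.1 hab, hba⟩ h
    · rintro ⟨i, u, h1, h2, rfl⟩
      exact ⟨_, _, (after_iff_lex i u).1 h1, h2, (lineThrough_inl hp hB hdet i u).symm⟩

end Flats

section Assembly

open Polynomial

open scoped Classical

variable {p m : ℕ}

theorem isStrictTotalOrder_and_increasingFront_iff {n : ℕ}
    (ρ : Fin p ⊕ Fin n → Fin p ⊕ Fin n → Prop) :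
    IsStrictTotalOrder _ ρ ∧ IncreasingFront ρ ↔
      ρ ∈ extensions (· < ·) p ∧ ∃ i, code ρ i = 0 := by
  rw [mem_extensions, and_assoc]
  refine and_congr_right fun h => ?_
  rw [← exists_front_iff, IncreasingFront]
  refine and_congr_left fun _ => ⟨fun hinc k l => ⟨fun hkl => ?_, hinc k l⟩, fun h k l => (h k l).2⟩
  rcases lt_trichotomy k l with h' | rfl | h'
  · exact h'
  · exact absurd hkl (irrefl _)
  · exact absurd hkl (asymm (hinc _ _ h'))

theorem isStrictTotalOrder_and_increasingFront_swap_iff {n : ℕ}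
    (ρ : Fin p ⊕ Fin n → Fin p ⊕ Fin n → Prop) :
    IsStrictTotalOrder _ ρ ∧ IncreasingFront (Function.swap ρ) ↔
      ρ ∈ extensions (· > ·) p ∧ ∃ i : Fin p, code ρ i + 1 = Fintype.card (Fin n) + (p - i) := by
  rw [mem_extensions, and_assoc]
  refine and_congr_right fun h => ?_
  rw [← exists_back_iff, IncreasingFront]
  refine and_congr_left fun _ => ⟨fun hdec k l => ⟨fun hkl => ?_, hdec l k⟩, fun h k l => (h l k).2⟩
  rcases lt_trichotomy k l with hlt | rfl | hlt
  · exact absurd hkl (asymm (hdec _ _ hlt))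
  · exact absurd hkl (irrefl _)
  · exact hlt

/-- The `q`-count of separated orders, relative to the standard order. -/
theorem finsum_separated {A B : Fin (m + 1) → ℝ} (hp : 1 ≤ p) (hm : 1 ≤ m) (hA : ∀ k, 0 ≤ A k)
    (hB : ∀ k, 0 < B k) (hAB : ∀ k, A k ≤ B k) (hdet : ∀ k l, k < l → A l * B k < A k * B l) :
    (∑ᶠ ρ ∈ {ρ : Fin (p + 1) ⊕ Fin (m + 1) → Fin (p + 1) ⊕ Fin (m + 1) → Prop |
        IsStrictTotalOrder _ ρ ∧ Separated (planarExtension A B) ρ},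
      (X : ℤ[X]) ^ {F | IsLine (planarExtension A B) F ∧
        ∃ a ∈ F, ∃ b ∈ F, Sum.Lex (· < ·) (· < ·) a b ∧ ρ b a}.ncard) * qfact (m + 1)
      = (1 + X ^ (m + 2)) * qnum (p + 1) * qfact (m + 1 + p) := by
  set F₁ : Finset (Fin (p + 1) ⊕ Fin (m + 1) → Fin (p + 1) ⊕ Fin (m + 1) → Prop) :=
    {ρ ∈ extensions (· < ·) (p + 1) | ∃ i, code ρ i = 0} with hF₁
  set F₂ : Finset (Fin (p + 1) ⊕ Fin (m + 1) → Fin (p + 1) ⊕ Fin (m + 1) → Prop) :=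
    {ρ ∈ extensions (· > ·) (p + 1) |
      ∃ i, code ρ i + 1 = Fintype.card (Fin (m + 1)) + (p + 1 - i)} with hF₂
  have h01 : (0 : Fin (m + 1)) < Fin.last m := Fin.lt_def.2 hm
  have hset : {ρ | IsStrictTotalOrder _ ρ ∧ Separated (planarExtension A B) ρ}
      = ((F₁ ∪ F₂ : Finset _) :
        Set (Fin (p + 1) ⊕ Fin (m + 1) → Fin (p + 1) ⊕ Fin (m + 1) → Prop)) := by
    ext ρ
    rw [Finset.mem_coe, Finset.mem_union, hF₁, hF₂, Finset.mem_filter, Finset.mem_filter,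
      ← isStrictTotalOrder_and_increasingFront_iff,
      ← isStrictTotalOrder_and_increasingFront_swap_iff, ← and_or_left]
    exact and_congr_right fun h =>
      separated_planarExtension_iff (by omega) hA hB hAB hdet ρ
  have hdisj : Disjoint F₁ F₂ := by
    refine Finset.disjoint_left.2 fun ρ h1 h2 => ?_
    have h1 := (mem_extensions.1 (Finset.mem_filter.1 h1).1).2 0 (Fin.last m)
    have h2 := (mem_extensions.1 (Finset.mem_filter.1 h2).1).2 0 (Fin.last m)
    exact lt_asymm h01 (h2.1 (h1.2 h01))
  have e1 : ∀ ρ ∈ F₁, (X : ℤ[X]) ^ {F | IsLine (planarExtension A B) F ∧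
      ∃ a ∈ F, ∃ b ∈ F, Sum.Lex (· < ·) (· < ·) a b ∧ ρ b a}.ncard = X ^ ∑ i, code ρ i := by
    intro ρ hρ
    have h := (mem_extensions.1 (Finset.mem_filter.1 hρ).1).2
    rw [ncard_inverted (by omega) hB hdet, if_neg, add_zero]
    rintro ⟨k, l, hkl, hlk⟩
    exact lt_asymm hkl ((h l k).1 hlk)
  have e2 : ∀ ρ ∈ F₂, (X : ℤ[X]) ^ {F | IsLine (planarExtension A B) F ∧
      ∃ a ∈ F, ∃ b ∈ F, Sum.Lex (· < ·) (· < ·) a b ∧ ρ b a}.ncard = X * X ^ ∑ i, code ρ i := by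
    intro ρ hρ
    have h := (mem_extensions.1 (Finset.mem_filter.1 hρ).1).2
    rw [ncard_inverted (by omega) hB hdet, if_pos ⟨0, Fin.last m, h01, (h _ _).2 h01⟩, pow_succ']
  rw [hset, finsum_mem_coe_finset, Finset.sum_union hdisj, Finset.sum_congr rfl e1,
    Finset.sum_congr rfl e2, ← Finset.mul_sum, add_mul, mul_assoc]
  have s1 := sum_front_mul_qfact m p (· < ·)
  have s2 := sum_back_mul_qfact m p (· > ·)
  have t1 : (∑ ρ ∈ F₁, (X : ℤ[X]) ^ ∑ i, code ρ i) * qfact (m + 1)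
      = qnum (p + 1) * qfact (m + 1 + p) := by
    rw [← s1]
  have t2 : (∑ ρ ∈ F₂, (X : ℤ[X]) ^ ∑ i, code ρ i) * qfact (m + 1)
      = X ^ (m + 1) * qnum (p + 1) * qfact (m + 1 + p) := by
    rw [← s2]
  rw [t1, t2]
  ring

/-- The relabelling moving the last basis vector to the end of the vectors `a_i`. -/
def regroup (p m : ℕ) : Fin p ⊕ Fin (m + 1) ≃ Fin (p + 1) ⊕ Fin m where
  toFun := Sum.elim (fun i => Sum.inl i.castSucc) (Fin.lastCases (Sum.inl (Fin.last p)) Sum.inr)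
  invFun := Sum.elim (Fin.lastCases (Sum.inr (Fin.last m)) Sum.inl) fun k => Sum.inr k.castSucc
  left_inv := by
    rintro (i | k)
    · simp
    · induction k using Fin.lastCases <;> simp
  right_inv := by
    rintro (i | k)
    · induction i using Fin.lastCases <;> simp
    · simp

theorem gamma0_regroup_iff (a b : Fin p ⊕ Fin (m + 1)) :
    gamma0 (p + 1) m (regroup p m a) (regroup p m b) ↔ Sum.Lex (· < ·) (· < ·) a b := by
  have key : ∀ u, Sum.elim (fun j : Fin (p + 1) => if (j : ℕ) < p + 1 - 1 then (j : ℕ)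
      else p + 1 - 1 + m) (fun i : Fin m => p + 1 - 1 + (i : ℕ)) (regroup p m u)
      = Sum.elim (fun i : Fin p => (i : ℕ)) (fun k : Fin (m + 1) => p + (k : ℕ)) u := by
    rintro (i | k)
    · simp [regroup]
    · induction k using Fin.lastCases <;> simp [regroup]
  rw [gamma0, key, key]
  rcases a with i | k <;> rcases b with j | l
  · simp
  · simp; omega
  · simp; omega
  · simp

theorem isRank2Flat_iff_isLine_preimage (v : Fin (p + 1) ⊕ Fin m → Fin (p + 1) → ℝ)
    (F : Set (Fin (p + 1) ⊕ Fin m)) :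
    IsRank2Flat v F ↔ IsLine (v ∘ regroup p m) (regroup p m ⁻¹' F) := by
  rw [IsRank2Flat, IsLine, Set.image_comp, Set.image_preimage_eq F (regroup p m).surjective,
    (regroup p m).surjective.forall]
  rfl

theorem L2dist_eq_ncard (v : Fin (p + 1) ⊕ Fin m → Fin (p + 1) → ℝ)
    (γ : Fin (p + 1) ⊕ Fin m → Fin (p + 1) ⊕ Fin m → Prop) :
    L2dist v (gamma0 (p + 1) m) γ = {F | IsLine (v ∘ regroup p m) F ∧
      ∃ a ∈ F, ∃ b ∈ F, Sum.Lex (· < ·) (· < ·) a b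
        ∧ γ (regroup p m b) (regroup p m a)}.ncard := by
  have hinj : Function.Injective fun F : Set (Fin (p + 1) ⊕ Fin m) => regroup p m ⁻¹' F :=
    (regroup p m).surjective.preimage_injective
  rw [L2dist, ← Set.ncard_image_of_injective _ hinj]
  congr 1
  ext F
  constructor
  · rintro ⟨G, ⟨hG, a, ha, b, hb, hab, hba⟩, rfl⟩
    obtain ⟨a, rfl⟩ := (regroup p m).surjective a
    obtain ⟨b, rfl⟩ := (regroup p m).surjective b
    exact ⟨(isRank2Flat_iff_isLine_preimage v G).1 hG, a, ha, b, hb,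
      (gamma0_regroup_iff a b).1 hab, hba⟩
  · rintro ⟨hF, a, ha, b, hb, hab, hba⟩
    have hpre : regroup p m ⁻¹' (regroup p m '' F) = F :=
      Set.preimage_image_eq F (regroup p m).injective
    refine ⟨regroup p m '' F, ⟨?_, _, Set.mem_image_of_mem _ ha, _, Set.mem_image_of_mem _ hb,
      (gamma0_regroup_iff a b).2 hab, hba⟩, hpre⟩
    rw [isRank2Flat_iff_isLine_preimage, hpre]
    exact hF

theorem isMonotonePathOrder_iff_separated (v : Fin (p + 1) ⊕ Fin m → Fin (p + 1) → ℝ)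
    (γ : Fin (p + 1) ⊕ Fin m → Fin (p + 1) ⊕ Fin m → Prop) :
    IsMonotonePathOrder v γ ↔
      IsStrictTotalOrder _ (fun a b => γ (regroup p m a) (regroup p m b)) ∧
        Separated (v ∘ regroup p m) fun a b => γ (regroup p m a) (regroup p m b) := by
  refine and_congr ⟨fun h => isStrictTotalOrder_comap γ _ (regroup p m).injective, fun h => ?_⟩ ?_
  · simpa using isStrictTotalOrder_comap (fun a b => γ (regroup p m a) (regroup p m b))
      (regroup p m).symm (regroup p m).symm.injective
  · simp only [Separated, (regroup p m).surjective.forall, Function.comp_apply]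

theorem comp_regroup_eq (v : Fin (p + 1) ⊕ Fin m → Fin (p + 1) → ℝ)
    (hv1 : ∀ j, v (Sum.inl j) = Pi.single j 1)
    (hv2 : ∀ i : Fin m, v (Sum.inr i)
      = fun k : Fin (p + 1) => (if (k : ℕ) = p + 1 - 1 then ((i : ℕ) + 1 : ℝ) else 0) + 1) :
    v ∘ regroup p m = planarExtension (fun k : Fin (m + 1) => if (k : ℕ) = m then (0 : ℝ) else 1)
      fun k : Fin (m + 1) => if (k : ℕ) = m then (1 : ℝ) else k + 2 := by
  funext u
  rcases u with i | k
  · exact hv1 i.castSucc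
  · induction k using Fin.lastCases with
    | last => simp [regroup, hv1, planarExtension]
    | cast k =>
      have hk : (k : ℕ) ≠ m := k.2.ne
      ext j
      induction j using Fin.lastCases with
      | last =>
        rw [planarExtension_inr_last]
        simp [regroup, hv2, hk]
        ring
      | cast j =>
        rw [planarExtension_inr_castSucc]
        simp [regroup, hv2, hk, j.2.ne]

end Assembly

/-- The `q`-count of monotone path orders of `E_{r,m}` by `L_2`-distance
from `γ_0` satisfies
`(∑_γ q^{L_2(γ_0,γ)}) · [m+1]_q! · [r−2]_q! = (1 + q^{m+2}) · [r−1]_q! · [m+r−1]_q!`. -/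
theorem statement14 (r m : ℕ) (hr : 3 ≤ r) (hm : 1 ≤ m)
    (v : Fin r ⊕ Fin m → Fin r → ℝ)
    (hv1 : ∀ j : Fin r, v (Sum.inl j) = Pi.single j 1)
    (hv2 : ∀ i : Fin m, v (Sum.inr i)
      = fun k : Fin r => (if (k : ℕ) = r - 1 then ((i : ℕ) + 1 : ℝ) else 0) + 1) :
    (∑ᶠ γ ∈ {γ | IsMonotonePathOrder v γ},
        (Polynomial.X : Polynomial ℤ) ^ L2dist v (gamma0 r m) γ)
      * qfact (m + 1) * qfact (r - 2)
    = (1 + Polynomial.X ^ (m + 2)) * qfact (r - 1) * qfact (m + r - 1) := by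
  obtain ⟨p, rfl⟩ : ∃ p, r = p + 1 + 1 := ⟨r - 2, by omega⟩
  have hcomp := comp_regroup_eq v hv1 hv2
  set A : Fin (m + 1) → ℝ := fun k => if (k : ℕ) = m then (0 : ℝ) else 1 with hA
  set B : Fin (m + 1) → ℝ := fun k => if (k : ℕ) = m then (1 : ℝ) else k + 2 with hB
  have hmain := finsum_separated (p := p) (A := A) (B := B) (by omega) hm
    (fun k => by simp only [hA]; split_ifs <;> norm_num)
    (fun k => by simp only [hB]; split_ifs <;> positivity)
    (fun k => by
      have : (0 : ℝ) ≤ (k : ℕ) := Nat.cast_nonneg _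
      simp only [hA, hB]; split_ifs <;> linarith)
    (fun k l hkl => by
      have hkl' : ((k : ℕ) : ℝ) < (l : ℕ) := Nat.cast_lt.2 hkl
      have hk : (k : ℕ) ≠ m := by have := Fin.lt_def.1 hkl; omega
      simp only [hA, hB, hk, if_false]
      split_ifs <;> linarith)
  have hsum : ∑ᶠ γ ∈ {γ | IsMonotonePathOrder v γ},
      (Polynomial.X : Polynomial ℤ) ^ L2dist v (gamma0 (p + 1 + 1) m) γ
      = ∑ᶠ ρ ∈ {ρ : Fin (p + 1) ⊕ Fin (m + 1) → Fin (p + 1) ⊕ Fin (m + 1) → Prop |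
        IsStrictTotalOrder _ ρ ∧ Separated (planarExtension A B) ρ},
      (Polynomial.X : Polynomial ℤ) ^ {F | IsLine (planarExtension A B) F ∧
        ∃ a ∈ F, ∃ b ∈ F, Sum.Lex (· < ·) (· < ·) a b ∧ ρ b a}.ncard := by
    refine finsum_mem_eq_of_bijOn ((regroup (p + 1) m).symm.arrowCongr
      ((regroup (p + 1) m).symm.arrowCongr (Equiv.refl Prop))) (Equiv.bijOn _ fun γ => ?_)
      fun γ _ => ?_
    · rw [← hcomp]
      exact (isMonotonePathOrder_iff_separated v γ).symm
    · rw [L2dist_eq_ncard, hcomp]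
      rfl
  have hq : qfact (p + 1 + 1 - 1) = qfact p * qnum (p + 1) := qfact_succ p
  rw [hsum, hmain, hq, show p + 1 + 1 - 2 = p by omega,
    show m + (p + 1 + 1) - 1 = m + 1 + p by omega]
  ring
end

section
/- Let (v, π) be a configuration with π(v e) = 1 for every e ∈ E, v injective, and let r = dim span{v e : e ∈ E}. Suppose there is no cellular string (E_1, …, E_l) of (v, π) with l ≥ 2 such that ∑_{i=1}^l (dim span{v e : e ∈ E_i} − 1) ≥ r − 1. Let P = {v e : e ∈ E} and let a_1, a_2 be two distinct points of P that are not extreme points of conv P. Then there exists an extreme point b of conv P such that a_1, a_2, b are collinear. -/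
open Finset

section CommonDefs

variable {E : Type*} [Fintype E] {V : Type*} [AddCommGroup V] [Module ℝ V]

/-- An ordered set partition of the finite index set `E` with `l` blocks is encoded by a
surjective block map `b : E → Fin l` (block `E_i = b⁻¹ i`, blocks listed in the order of
`Fin l`).  Such an ordered set partition is a *cellular string* of the configuration `v` if
for each block index `i` there is a linear functional vanishing on the vectors of block `i`,
negative on the vectors of earlier blocks and positive on the vectors of later blocks. -/
def IsCellularString (v : E → V) (l : ℕ) (b : E → Fin l) : Prop :=
  Function.Surjective b ∧
  ∀ i : Fin l, ∃ φ : V →ₗ[ℝ] ℝ, ∀ e : E,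
    (b e = i → φ (v e) = 0) ∧ (b e < i → φ (v e) < 0) ∧ (i < b e → 0 < φ (v e))

/-- A cellular string (ordered set partition) is *coherent* for the configuration `(v, π)` if
some linear functional `ψ` orders the ratios `ψ(v e)/π(v e)` according to the blocks:
equal within a block, strictly increasing between blocks. -/
def IsCoherent (v : E → V) (π : V →ₗ[ℝ] ℝ) (l : ℕ) (b : E → Fin l) : Prop :=
  ∃ ψ : V →ₗ[ℝ] ℝ, ∀ e e' : E,
    (b e = b e' → ψ (v e) / π (v e) = ψ (v e') / π (v e')) ∧
    (b e < b e' → ψ (v e) / π (v e) < ψ (v e') / π (v e'))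

/-- The configuration `(v, π)` is *all-coherent* if every cellular string is coherent. -/
def AllCoherent (v : E → V) (π : V →ₗ[ℝ] ℝ) : Prop :=
  ∀ (l : ℕ) (b : E → Fin l), IsCellularString v l b → IsCoherent v π l b

end CommonDefs

section Strings

variable {E : Type*} {V : Type*} [AddCommGroup V] [Module ℝ V]

/-- The number `dim span {v e : e ∈ S} - 1` contributed by a block `S`. -/
noncomputable def blockDim (v : E → V) (S : Set E) : ℤ :=
  (Module.finrank ℝ (Submodule.span ℝ (v '' S)) : ℤ) - 1

lemma blockDim_nonneg [FiniteDimensional ℝ V] {v : E → V} {S : Set E} {e : E} (he : e ∈ S)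
    (hv : v e ≠ 0) : 0 ≤ blockDim v S := by
  have h : 0 < Module.finrank ℝ (Submodule.span ℝ (v '' S)) := by
    apply Submodule.one_le_finrank_iff.2
    intro h
    exact hv (Submodule.span_eq_bot.1 h _ ⟨e, he, rfl⟩)
  unfold blockDim
  omega

variable [Fintype E]

/-- Sorting the elements of `E` by a function `τ` whose strict inequalities are realised by linear
functionals yields a cellular string. -/
lemma exists_isCellularString_of_sort [FiniteDimensional ℝ V] {T : Type*} [LinearOrder T]
    {v : E → V} (hv : ∀ e, v e ≠ 0) (τ : E → T)
    (hτ : ∀ e₀, ∃ φ : V →ₗ[ℝ] ℝ, ∀ e, (τ e = τ e₀ → φ (v e) = 0) ∧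
      (τ e < τ e₀ → φ (v e) < 0) ∧ (τ e₀ < τ e → 0 < φ (v e)))
    (S : Finset T) (hS : ∀ s ∈ S, ∃ e, τ e = s) :
    ∃ (l : ℕ) (b : E → Fin l), IsCellularString v l b ∧ #S ≤ l ∧
      ∑ s ∈ S, blockDim v {e | τ e = s} ≤ ∑ i, blockDim v {e | b e = i} := by
  classical
  let T₀ : Finset T := univ.image τ
  let iso : Fin #T₀ ≃o T₀ := T₀.orderIsoOfFin rfl
  let τ' : E → T₀ := fun e ↦ ⟨τ e, mem_image_of_mem τ (mem_univ e)⟩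
  have hT₀ : S ⊆ T₀ := fun s hs ↦ by
    obtain ⟨e, rfl⟩ := hS s hs
    exact mem_image_of_mem τ (mem_univ e)
  refine ⟨#T₀, fun e ↦ iso.symm (τ' e), ⟨fun i ↦ ?_, fun i ↦ ?_⟩, card_le_card hT₀, ?_⟩
  · obtain ⟨e, -, he⟩ := mem_image.1 (iso i).2
    exact ⟨e, by rw [OrderIso.symm_apply_eq]; exact Subtype.ext he⟩
  · obtain ⟨e₀, -, he₀⟩ := mem_image.1 (iso i).2
    obtain ⟨φ, hφ⟩ := hτ e₀
    have hi : i = iso.symm (τ' e₀) := by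
      rw [eq_comm, OrderIso.symm_apply_eq]; exact Subtype.ext he₀
    subst hi
    refine ⟨φ, fun e ↦ ?_⟩
    simpa [τ'] using hφ e
  · have h : ∀ i, {e | iso.symm (τ' e) = i} = {e | τ e = (iso i : T)} := fun i ↦ by
      ext e
      simp [OrderIso.symm_apply_eq, Subtype.ext_iff, τ']
    simp only [h]
    rw [show ∑ i, blockDim v {e | τ e = (iso i : T)} = ∑ t : T₀, blockDim v {e | τ e = (t : T)} from
      iso.toEquiv.sum_comp fun t : T₀ ↦ blockDim v {e | τ e = (t : T)},
      sum_coe_sort T₀ (fun t ↦ blockDim v {e | τ e = t})]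
    refine sum_le_sum_of_subset_of_nonneg hT₀ fun t ht _ ↦ ?_
    obtain ⟨e, -, he⟩ := mem_image.1 ht
    exact blockDim_nonneg (e := e) he (hv e)

/-- A sequence of linear functionals, from one positive on the configuration to one negative on it,
along which nonpositive values become negative, can be refined to a cellular string whose blocks
include the nonempty zero sets of the functionals. -/
lemma exists_isCellularString_of_chain [FiniteDimensional ℝ V] {v : E → V}
    (g : ℕ → V →ₗ[ℝ] ℝ) (hpos : ∀ e, 0 < g 0 (v e))
    (hg : ∀ i e, g i (v e) ≤ 0 → g (i + 1) (v e) < 0)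
    {N : ℕ} (hneg : ∀ e, g N (v e) < 0)
    (I : Finset ℕ) (hI : ∀ i ∈ I, ∃ e, g i (v e) = 0) :
    ∃ (l : ℕ) (b : E → Fin l), IsCellularString v l b ∧ #I ≤ l ∧
      ∑ i ∈ I, blockDim v {e | g i (v e) = 0} ≤ ∑ i, blockDim v {e | b e = i} := by
  classical
  have hlt : ∀ {i j : ℕ} {e : E}, i < j → g i (v e) ≤ 0 → g j (v e) < 0 := by
    intro i j e hij h
    induction j, hij using Nat.le_induction with
    | base => exact hg i e h
    | succ j _ ih => exact hg j e ih.le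
  have hex : ∀ e, ∃ m, 0 < g m (v e) ∧ g (m + 1) (v e) ≤ 0 := by
    intro e
    by_contra! h
    have : ∀ m, 0 < g m (v e) := fun m ↦ by
      induction m with
      | zero => exact hpos e
      | succ m ih => exact h m ih
    exact (this N).not_gt (hneg e)
  choose m hm hm' using hex
  let A : E → ℝ := fun e ↦ g (m e) (v e)
  let B : E → ℝ := fun e ↦ g (m e + 1) (v e)
  have hAB : ∀ e, 0 < A e - B e := fun e ↦ sub_pos.2 ((hm' e).trans_lt (hm e))
  let τ : E → ℕ ×ₗ ℝ := fun e ↦ toLex (m e, A e / (A e - B e))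
  have hτ : ∀ e i, τ e = toLex (i, 1) ↔ g (i + 1) (v e) = 0 := by
    intro e i
    simp only [τ, toLex_inj, Prod.mk.injEq, div_eq_one_iff_eq (hAB e).ne']
    constructor
    · rintro ⟨rfl, h⟩
      change B e = 0
      linarith
    · intro h
      have hi : m e = i := by
        refine le_antisymm ?_ ?_
        · by_contra! hlt'
          rcases (Nat.succ_le_of_lt hlt').eq_or_lt with h' | h'
          · exact (hm e).ne' (h' ▸ h)
          · exact (hlt h' h.le).not_gt (hm e)
        · by_contra! hlt'
          exact (hlt (Nat.succ_lt_succ hlt') (hm' e)).ne h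
      subst hi
      refine ⟨rfl, ?_⟩
      change A e = A e - g (m e + 1) (v e)
      rw [h, sub_zero]
  have hI0 : ∀ i ∈ I, ∃ j, j + 1 = i := by
    intro i hi
    obtain ⟨e, he⟩ := hI i hi
    rcases i with _ | j
    · exact absurd he (hpos e).ne'
    · exact ⟨j, rfl⟩
  have hinj : Set.InjOn (fun i : ℕ ↦ (toLex (i - 1, 1) : ℕ ×ₗ ℝ)) I := by
    intro i hi j hj hij
    obtain ⟨i, rfl⟩ := hI0 i hi
    obtain ⟨j, rfl⟩ := hI0 j hj
    simpa using hij
  have hφ : ∀ e₀, ∃ φ : V →ₗ[ℝ] ℝ, ∀ e, (τ e = τ e₀ → φ (v e) = 0) ∧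
      (τ e < τ e₀ → φ (v e) < 0) ∧ (τ e₀ < τ e → 0 < φ (v e)) := by
    intro e₀
    have hlam : 0 < A e₀ / (A e₀ - B e₀) := div_pos (hm e₀) (hAB e₀)
    have hlam' : A e₀ / (A e₀ - B e₀) ≤ 1 := by
      rw [div_le_one (hAB e₀)]
      linarith [hm' e₀]
    set c := A e₀ / (A e₀ - B e₀) with hc
    have hsame : ∀ e, m e = m e₀ → (1 - c) * g (m e₀) (v e) + c * g (m e₀ + 1) (v e) =
        (A e / (A e - B e) - c) * (A e - B e) := by
      intro e he
      rw [← he, sub_mul (A e / _), div_mul_cancel₀ _ (hAB e).ne']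
      ring
    refine ⟨(1 - c) • g (m e₀) + c • g (m e₀ + 1), fun e ↦ ⟨fun h ↦ ?_, fun h ↦ ?_, fun h ↦ ?_⟩⟩
    · simp only [τ, toLex_inj, Prod.mk.injEq] at h
      simp [hsame e h.1, h.2, ← hc]
    · simp only [τ, Prod.Lex.toLex_lt_toLex] at h
      simp only [LinearMap.add_apply, LinearMap.smul_apply, smul_eq_mul]
      rcases h with h | ⟨h, h'⟩
      · have h1 : g (m e₀) (v e) ≤ 0 := by
          rcases (Nat.succ_le_of_lt h).eq_or_lt with h' | h'
          · exact h' ▸ hm' e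
          · exact (hlt h' (hm' e)).le
        have h2 := hg _ _ h1
        nlinarith
      · rw [hsame e h]
        exact mul_neg_of_neg_of_pos (sub_neg.2 h') (hAB e)
    · simp only [τ, Prod.Lex.toLex_lt_toLex] at h
      simp only [LinearMap.add_apply, LinearMap.smul_apply, smul_eq_mul]
      rcases h with h | ⟨h, h'⟩
      · have h1 : 0 < g (m e₀) (v e) := by
          by_contra! h'
          exact (hlt h h').not_gt (hm e)
        have h2 : 0 < g (m e₀ + 1) (v e) := by
          by_contra! h'
          rcases (Nat.succ_le_of_lt h).eq_or_lt with h'' | h''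
          · rw [Nat.succ_eq_add_one] at h''
            exact (h'' ▸ h').not_gt (hm e)
          · exact (hlt h'' h').not_gt (hm e)
        nlinarith
      · rw [hsame e h.symm]
        exact mul_pos (sub_pos.2 h') (hAB e)
  have hS : ∀ s ∈ I.image fun i ↦ (toLex (i - 1, 1) : ℕ ×ₗ ℝ), ∃ e, τ e = s := by
    intro s hs
    obtain ⟨i, hi, rfl⟩ := mem_image.1 hs
    obtain ⟨e, he⟩ := hI i hi
    obtain ⟨i, rfl⟩ := hI0 i hi
    exact ⟨e, by simpa [hτ] using he⟩
  obtain ⟨l, b, hb, hl, hsum⟩ := exists_isCellularString_of_sort (v := v)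
    (fun e h ↦ (hpos e).ne' (by rw [h, map_zero])) τ hφ _ hS
  refine ⟨l, b, hb, ?_, ?_⟩
  · rwa [card_image_of_injOn hinj] at hl
  · rw [sum_image hinj] at hsum
    refine (sum_congr rfl fun i hi ↦ ?_).trans_le hsum
    obtain ⟨i, rfl⟩ := hI0 i hi
    simp [hτ]

end Strings

section Facets

variable {E : Type*} {V : Type*} [AddCommGroup V] [Module ℝ V]

/-- A linear functional `f` nonnegative on the configuration can be modified to one vanishing on
a further vector while keeping its zeros and its value at a given vector. -/
lemma exists_nonneg_functional_finrank_lt [Fintype E] [FiniteDimensional ℝ V] {v : E → V}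
    {f : V →ₗ[ℝ] ℝ} (hf : ∀ e, 0 ≤ f (v e)) {e₀ : E} (hf₀ : 0 < f (v e₀))
    (hr : Module.finrank ℝ (Submodule.span ℝ (v '' {e | f (v e) = 0})) + 1 <
      Module.finrank ℝ (Submodule.span ℝ (Set.range v))) :
    ∃ f' : V →ₗ[ℝ] ℝ, (∀ e, 0 ≤ f' (v e)) ∧ 0 < f' (v e₀) ∧
      Module.finrank ℝ (Submodule.span ℝ (v '' {e | f (v e) = 0})) <
        Module.finrank ℝ (Submodule.span ℝ (v '' {e | f' (v e) = 0})) := by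
  classical
  set Z := Submodule.span ℝ (v '' {e | f (v e) = 0}) with hZ
  obtain ⟨g, hgZ, hg₀, e₁, he₁⟩ : ∃ g : V →ₗ[ℝ] ℝ, (∀ e, f (v e) = 0 → g (v e) = 0) ∧
      g (v e₀) = 0 ∧ ∃ e, g (v e) < 0 := by
    have hrank : Module.finrank ℝ ↥(Z ⊔ Submodule.span ℝ {v e₀}) <
        Module.finrank ℝ (Submodule.span ℝ (Set.range v)) := by
      have h1 := Submodule.finrank_add_le_finrank_add_finrank Z (Submodule.span ℝ {v e₀})
      have h2 : Module.finrank ℝ (Submodule.span ℝ {v e₀}) ≤ 1 :=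
        (finrank_span_le_card ({v e₀} : Set V)).trans (by simp)
      omega
    obtain ⟨e, he⟩ : ∃ e, v e ∉ Z ⊔ Submodule.span ℝ {v e₀} := by
      by_contra! h
      refine hrank.not_ge (Submodule.finrank_mono (Submodule.span_le.2 ?_))
      rintro _ ⟨e, rfl⟩
      exact h e
    obtain ⟨g, hg, hgle⟩ := Submodule.exists_le_ker_of_notMem he
    have h1 : ∀ e, f (v e) = 0 → g (v e) = 0 := fun e he ↦
      hgle (Submodule.mem_sup_left (Submodule.subset_span ⟨e, he, rfl⟩))
    have h2 : g (v e₀) = 0 :=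
      hgle (Submodule.mem_sup_right (Submodule.mem_span_singleton_self _))
    rcases lt_or_gt_of_ne hg with hg | hg
    · exact ⟨g, h1, h2, e, hg⟩
    · exact ⟨-g, fun e he ↦ by simp [h1 e he], by simp [h2], e, by simpa using hg⟩
  obtain ⟨e₂, he₂, hmin⟩ := exists_min_image ({e | g (v e) < 0} : Finset E)
    (fun e ↦ f (v e) / -g (v e)) ⟨e₁, by simpa using he₁⟩
  simp only [mem_filter, mem_univ, true_and] at he₂ hmin
  set t := f (v e₂) / -g (v e₂) with ht
  have hf₂ : 0 < f (v e₂) := (hf e₂).lt_of_ne' fun h ↦ he₂.ne (hgZ e₂ h)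
  have ht₀ : 0 ≤ t := div_nonneg (hf e₂) (by linarith)
  have hzero : f (v e₂) + t * g (v e₂) = 0 := by
    rw [ht]
    field_simp [he₂.ne]
    ring
  refine ⟨f + t • g, fun e ↦ ?_, ?_, ?_⟩
  · rcases lt_or_ge (g (v e)) 0 with h | h
    · have h' := (le_div_iff₀ (neg_pos.2 h)).1 (hmin e h)
      simp only [LinearMap.add_apply, LinearMap.smul_apply, smul_eq_mul]
      linarith
    · have := mul_nonneg ht₀ h
      simpa using add_nonneg (hf e) this
  · simpa [hg₀] using hf₀
  · refine Submodule.finrank_lt_finrank_of_lt (lt_of_le_of_ne (Submodule.span_mono ?_) fun h ↦ ?_)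
    · refine Set.image_mono fun e (he : f (v e) = 0) ↦ ?_
      simp [he, hgZ e he]
    · have h₂ : v e₂ ∈ Z := by
        rw [h]
        exact Submodule.subset_span ⟨e₂, by simpa using hzero, rfl⟩
      have hker : Z ≤ LinearMap.ker f := by
        rw [hZ, Submodule.span_le]
        rintro _ ⟨e, he, rfl⟩
        exact he
      exact hf₂.ne' (hker h₂)

/-- The cone over a configuration in an open half-space has a facet avoiding a given vector. -/
lemma exists_facet_functional [Fintype E] [FiniteDimensional ℝ V] {v : E → V} {π : V →ₗ[ℝ] ℝ}
    (hπ : ∀ e, 0 < π (v e)) (e₀ : E) :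
    ∃ f : V →ₗ[ℝ] ℝ, (∀ e, 0 ≤ f (v e)) ∧ 0 < f (v e₀) ∧
      Module.finrank ℝ (Submodule.span ℝ (Set.range v)) ≤
        Module.finrank ℝ (Submodule.span ℝ (v '' {e | f (v e) = 0})) + 1 := by
  suffices ∀ n < Module.finrank ℝ (Submodule.span ℝ (Set.range v)),
      ∃ f : V →ₗ[ℝ] ℝ, (∀ e, 0 ≤ f (v e)) ∧ 0 < f (v e₀) ∧
        n ≤ Module.finrank ℝ (Submodule.span ℝ (v '' {e | f (v e) = 0})) by
    rcases Nat.eq_zero_or_pos (Module.finrank ℝ (Submodule.span ℝ (Set.range v))) with h | h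
    · exact ⟨π, fun e ↦ (hπ e).le, hπ e₀, by omega⟩
    · obtain ⟨f, hf, hf₀, hn⟩ := this _ (Nat.sub_lt h one_pos)
      exact ⟨f, hf, hf₀, by omega⟩
  intro n
  induction n with
  | zero => exact fun _ ↦ ⟨π, fun e ↦ (hπ e).le, hπ e₀, Nat.zero_le _⟩
  | succ n ih =>
    intro hn
    obtain ⟨f, hf, hf₀, hnf⟩ := ih (by omega)
    by_cases h : n + 1 ≤ Module.finrank ℝ (Submodule.span ℝ (v '' {e | f (v e) = 0}))
    · exact ⟨f, hf, hf₀, h⟩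
    · obtain ⟨f', hf', hf₀', hlt⟩ := exists_nonneg_functional_finrank_lt hf hf₀ (by omega)
      exact ⟨f', hf', hf₀', by omega⟩

/-- If `f` is nonnegative on the configuration and positive at two vectors each of which can be
strictly separated from the rest, then both are zeros of a functional negative on the zeros
of `f`. -/
lemma exists_functional_eq_zero_and_neg_on_zeros {v : E → V} {π : V →ₗ[ℝ] ℝ}
    (hπ : ∀ e, 0 < π (v e)) {f : V →ₗ[ℝ] ℝ} {p q : E}
    (hp : 0 < f (v p)) (hq : 0 < f (v q)) (hpq : v p ≠ v q) {α β : V →ₗ[ℝ] ℝ}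
    (hαp : 0 < α (v p)) (hα : ∀ e, v e ≠ v p → α (v e) < 0)
    (hβq : 0 < β (v q)) (hβ : ∀ e, v e ≠ v q → β (v e) < 0) :
    ∃ h : V →ₗ[ℝ] ℝ, h (v p) = 0 ∧ h (v q) = 0 ∧ ∀ e, f (v e) = 0 → h (v e) < 0 := by
  obtain ⟨ε, hε, hεp, hεq⟩ : ∃ ε > 0, 0 < f (v p) - ε * π (v p) ∧ 0 < f (v q) - ε * π (v q) := by
    refine ⟨min (f (v p) / π (v p)) (f (v q) / π (v q)) / 2, ?_, ?_, ?_⟩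
    · have := div_pos hp (hπ p)
      have := div_pos hq (hπ q)
      positivity
    · have h1 := min_le_left (f (v p) / π (v p)) (f (v q) / π (v q))
      rw [le_div_iff₀ (hπ p)] at h1
      linarith
    · have h1 := min_le_right (f (v p) / π (v p)) (f (v q) / π (v q))
      rw [le_div_iff₀ (hπ q)] at h1
      linarith
  set μ : V →ₗ[ℝ] ℝ := f - ε • π with hμ
  have hμp : 0 < μ (v p) := by simpa [hμ] using hεp
  have hμq : 0 < μ (v q) := by simpa [hμ] using hεq
  have hαq := hα q hpq.symm
  have hβp := hβ p hpq
  have hπp := hπ p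
  have hπq := hπ q
  set a := μ (v p) * β (v q) - β (v p) * μ (v q) with ha
  set c := α (v p) * π (v q) - π (v p) * α (v q) with hc
  have ha' : 0 < a := by
    have := mul_pos hμp hβq
    have := mul_pos (neg_pos.2 hβp) hμq
    linarith
  have hc' : 0 < c := by
    have := mul_pos hαp hπq
    have := mul_pos hπp (neg_pos.2 hαq)
    linarith
  refine ⟨c • (μ (v p) • β - β (v p) • μ) + a • (π (v p) • α - α (v p) • π), ?_, ?_, fun e he ↦ ?_⟩
  · simp only [LinearMap.add_apply, LinearMap.sub_apply, LinearMap.smul_apply, smul_eq_mul]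
    ring
  · simp only [LinearMap.add_apply, LinearMap.sub_apply, LinearMap.smul_apply, smul_eq_mul, ha, hc]
    ring
  · have h1 : μ (v e) < 0 := by
      have := mul_pos hε (hπ e)
      simpa [hμ, he] using this
    have h2 : α (v e) < 0 := hα e fun h ↦ hp.ne' (h ▸ he)
    have h3 : β (v e) < 0 := hβ e fun h ↦ hq.ne' (h ▸ he)
    have h4 := hπ e
    have h5 : μ (v p) * β (v e) - β (v p) * μ (v e) < 0 := by
      have := mul_pos hμp (neg_pos.2 h3)
      have := mul_pos (neg_pos.2 hβp) (neg_pos.2 h1)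
      linarith
    have h6 : π (v p) * α (v e) - α (v p) * π (v e) < 0 := by
      have := mul_pos hπp (neg_pos.2 h2)
      have := mul_pos hαp h4
      linarith
    simpa using add_neg (mul_neg_of_pos_of_neg hc' h5) (mul_neg_of_pos_of_neg ha' h6)

end Facets

section ExtremePoints

variable {E : Type*} [Finite E] {V : Type*} [NormedAddCommGroup V] [NormedSpace ℝ V]

/-- An extreme point of the convex hull of a finite configuration on an affine hyperplane is
strictly separated from the other points by a linear functional. -/
lemma exists_functional_pos_and_neg_of_mem_extremePoints {v : E → V} {π : V →ₗ[ℝ] ℝ}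
    (hπ : ∀ e, π (v e) = 1) {p : V}
    (hp : p ∈ (convexHull ℝ (Set.range v)).extremePoints ℝ) :
    ∃ h : V →ₗ[ℝ] ℝ, 0 < h p ∧ ∀ e, v e ≠ p → h (v e) < 0 := by
  have hconv := ((convex_convexHull ℝ (Set.range v)).mem_extremePoints_iff_convex_sdiff.1 hp).2
  have hnot : p ∉ convexHull ℝ (Set.range v \ {p}) := fun h ↦
    (convexHull_min (Set.sdiff_subset_sdiff_left (subset_convexHull ℝ _)) hconv h).2 rfl
  have hfin : (Set.range v \ {p}).Finite := (Set.finite_range v).sdiff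
  obtain ⟨g, u, hg, hu⟩ := geometric_hahn_banach_point_closed (convex_convexHull ℝ _)
    (hfin.isClosed_convexHull ℝ) hnot
  obtain ⟨e, rfl⟩ := extremePoints_convexHull_subset hp
  refine ⟨u • π - g.toLinearMap, by simpa [hπ] using hg, fun e' he' ↦ ?_⟩
  simpa [hπ] using hu _ (subset_convexHull ℝ _ ⟨⟨e', rfl⟩, he'⟩)

/-- The configuration lies in the span of the extreme points of its convex hull. -/
lemma range_subset_span_extremePoints (v : E → V) :
    Set.range v ⊆ Submodule.span ℝ ((convexHull ℝ (Set.range v)).extremePoints ℝ) := by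
  have hfin := (Set.finite_range v).subset (extremePoints_convexHull_subset (𝕜 := ℝ))
  have h := closure_convexHull_extremePoints ((Set.finite_range v).isCompact_convexHull ℝ)
    (convex_convexHull ℝ _)
  rw [(hfin.isClosed_convexHull ℝ).closure_eq] at h
  exact (subset_convexHull ℝ _).trans
    (h.symm.subset.trans (convexHull_min Submodule.subset_span (Submodule.convex _)))

end ExtremePoints

section NoLongStrings

variable {E : Type*} {V : Type*} [NormedAddCommGroup V] [NormedSpace ℝ V]

/-- A point of an affine hyperplane in the linear span of two points of it is collinear with them. -/
lemma collinear_of_mem_span_pair {π : V →ₗ[ℝ] ℝ} {a b x : V} (ha : π a = 1) (hb : π b = 1)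
    (hx : π x = 1) (h : x ∈ Submodule.span ℝ {a, b}) : Collinear ℝ {a, b, x} := by
  obtain ⟨s, t, rfl⟩ := Submodule.mem_span_pair.1 h
  have hst : s + t = 1 := by simpa [ha, hb] using hx
  rw [collinear_iff_of_mem (p₀ := a) (by simp)]
  refine ⟨b - a, ?_⟩
  simp only [Set.mem_insert_iff, Set.mem_singleton_iff, forall_eq_or_imp, forall_eq, vadd_eq_add]
  refine ⟨⟨0, by simp⟩, ⟨1, by simp⟩, t, ?_⟩
  rw [eq_sub_of_add_eq hst]
  module

variable [FiniteDimensional ℝ V]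

lemma two_le_finrank_span {v : E → V} {π : V →ₗ[ℝ] ℝ} (hπ : ∀ e, π (v e) = 1)
    {S : Set E} {p q : E} (hp : p ∈ S) (hq : q ∈ S) (hpq : v p ≠ v q) :
    2 ≤ Module.finrank ℝ (Submodule.span ℝ (v '' S)) := by
  by_contra! h
  obtain ⟨w, hw⟩ := finrank_le_one_iff.1 (Nat.lt_succ_iff.1 h)
  obtain ⟨a, ha⟩ := hw ⟨v p, Submodule.subset_span ⟨p, hp, rfl⟩⟩
  obtain ⟨b, hb⟩ := hw ⟨v q, Submodule.subset_span ⟨q, hq, rfl⟩⟩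
  replace ha : a • (w : V) = v p := congrArg Subtype.val ha
  replace hb : b • (w : V) = v q := congrArg Subtype.val hb
  have h1 : a * π w = 1 := by rw [← hπ p, ← ha]; simp
  have h2 : b * π w = 1 := by rw [← hπ q, ← hb]; simp
  have hw0 : π w ≠ 0 := fun h0 ↦ by simp [h0] at h1
  exact hpq (by rw [← ha, ← hb, mul_right_cancel₀ hw0 (h1.trans h2.symm)])

variable [Fintype E]

/-- In the absence of cellular strings of large total dimension, every extreme point of the convex
hull has a functional nonnegative on the configuration, equal to `1` at this point and vanishing at
all other extreme points. -/
lemma exists_barycentric_coordinate {v : E → V} {π : V →ₗ[ℝ] ℝ} (hπ : ∀ e, π (v e) = 1)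
    (hr : 2 ≤ Module.finrank ℝ (Submodule.span ℝ (Set.range v)))
    (hstr : ¬ ∃ (l : ℕ) (b : E → Fin l), IsCellularString v l b ∧ 2 ≤ l ∧
      (Module.finrank ℝ (Submodule.span ℝ (Set.range v)) : ℤ) - 1 ≤
        ∑ i, blockDim v {e | b e = i})
    {x : V} (hx : x ∈ (convexHull ℝ (Set.range v)).extremePoints ℝ) :
    ∃ f : V →ₗ[ℝ] ℝ, (∀ e, 0 ≤ f (v e)) ∧ f x = 1 ∧
      ∀ y ∈ (convexHull ℝ (Set.range v)).extremePoints ℝ, y ≠ x → f y = 0 := by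
  have hπ' : ∀ e, 0 < π (v e) := fun e ↦ by simp [hπ]
  obtain ⟨p, rfl⟩ := extremePoints_convexHull_subset hx
  obtain ⟨f, hf, hfp, hrank⟩ := exists_facet_functional hπ' p
  refine ⟨(f (v p))⁻¹ • f, fun e ↦ ?_, ?_, fun y hy hyx ↦ ?_⟩
  · simpa using mul_nonneg (inv_nonneg.2 hfp.le) (hf e)
  · simp [hfp.ne']
  obtain ⟨q, rfl⟩ := extremePoints_convexHull_subset hy
  suffices f (v q) = 0 by simp [this]
  by_contra hfq
  obtain ⟨α, hαp, hα⟩ := exists_functional_pos_and_neg_of_mem_extremePoints hπ hx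
  obtain ⟨β, hβq, hβ⟩ := exists_functional_pos_and_neg_of_mem_extremePoints hπ hy
  obtain ⟨h, hhp, hhq, hh⟩ := exists_functional_eq_zero_and_neg_on_zeros hπ' hfp
    ((hf q).lt_of_ne' hfq) hyx.symm hαp hα hβq hβ
  obtain ⟨e₀, he₀⟩ : ∃ e, f (v e) = 0 := by
    by_contra! hne
    have : {e | f (v e) = 0} = ∅ := by ext e; simp [hne e]
    rw [this] at hrank
    rw [Set.image_empty, Submodule.span_empty, finrank_bot] at hrank
    omega
  let g : ℕ → V →ₗ[ℝ] ℝ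
    | 0 => π
    | 1 => f
    | 2 => h
    | _ + 3 => -π
  have hg : ∀ i e, g i (v e) ≤ 0 → g (i + 1) (v e) < 0 := fun i e ↦ by
    match i with
    | 0 => simp [g, hπ]
    | 1 => exact fun hle ↦ hh e (hle.antisymm (hf e))
    | 2 => simp [g, hπ]
    | _ + 3 => simp [g, hπ]
  have hI : ∀ i ∈ ({1, 2} : Finset ℕ), ∃ e, g i (v e) = 0 := by
    simp only [mem_insert, mem_singleton, forall_eq_or_imp, forall_eq]
    exact ⟨⟨e₀, he₀⟩, p, hhp⟩
  obtain ⟨l, b, hb, hl, hsum⟩ := exists_isCellularString_of_chain (v := v) g (N := 3)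
    (fun e ↦ hπ' e) hg (fun e ↦ by simp [g, hπ]) _ hI
  refine hstr ⟨l, b, hb, by simpa using hl, le_trans ?_ hsum⟩
  have h2 := two_le_finrank_span hπ (S := {e | h (v e) = 0}) hhp hhq hyx.symm
  rw [sum_pair (by simp)]
  simp only [g, blockDim]
  omega

/-- In the absence of cellular strings of large total dimension, every functional vanishing at two
distinct points of the configuration vanishes at some extreme point of the convex hull. -/
lemma exists_mem_extremePoints_apply_eq_zero {v : E → V} {π : V →ₗ[ℝ] ℝ} (hπ : ∀ e, π (v e) = 1)
    (hstr : ¬ ∃ (l : ℕ) (b : E → Fin l), IsCellularString v l b ∧ 2 ≤ l ∧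
      (Module.finrank ℝ (Submodule.span ℝ (Set.range v)) : ℤ) - 1 ≤
        ∑ i, blockDim v {e | b e = i})
    {p q : E} (hpq : v p ≠ v q) {f : V →ₗ[ℝ] ℝ} (hp : f (v p) = 0) (hq : f (v q) = 0) :
    ∃ x ∈ (convexHull ℝ (Set.range v)).extremePoints ℝ, f x = 0 := by
  classical
  by_contra! hne
  set X := (convexHull ℝ (Set.range v)).extremePoints ℝ with hX
  have hr : 2 ≤ Module.finrank ℝ (Submodule.span ℝ (Set.range v)) := by
    rw [← Set.image_univ]
    exact two_le_finrank_span hπ (Set.mem_univ p) (Set.mem_univ q) hpq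
  have hXfin : X.Finite := (Set.finite_range v).subset extremePoints_convexHull_subset
  have hXv : X ⊆ Set.range v := extremePoints_convexHull_subset
  have hbary : ∀ x : X, ∃ f : V →ₗ[ℝ] ℝ, (∀ e, 0 ≤ f (v e)) ∧ f x = 1 ∧
      ∀ y : X, y ≠ x → f y = 0 := fun x ↦ by
    obtain ⟨f, hf, hfx, hfy⟩ := exists_barycentric_coordinate hπ hr hstr x.2
    exact ⟨f, hf, hfx, fun y hyx ↦ hfy y y.2 fun h ↦ hyx (Subtype.ext h)⟩
  choose c hc hcx hcy using hbary
  have : Fintype X := hXfin.fintype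
  have hinterp : ∀ (a : X → ℝ) (y : X), (∑ x, a x • c x : V →ₗ[ℝ] ℝ) y = a y := by
    intro a y
    have : ∀ x ≠ y, a x * c x y = 0 := fun x hx ↦ by rw [hcy x y hx.symm, mul_zero]
    simp only [LinearMap.sum_apply, LinearMap.smul_apply, smul_eq_mul]
    rw [Fintype.sum_eq_single _ this, hcx y, mul_one]
  have hrepr : ∀ (φ : V →ₗ[ℝ] ℝ) e, φ (v e) = ∑ x : X, φ x * c x (v e) := by
    intro φ e
    have heq : Set.EqOn φ (∑ x : X, φ x • c x : V →ₗ[ℝ] ℝ) X :=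
      fun y hy ↦ (hinterp (fun x ↦ φ x) ⟨y, hy⟩).symm
    have h := LinearMap.eqOn_span heq (range_subset_span_extremePoints v ⟨e, rfl⟩)
    simpa [LinearMap.sum_apply] using h
  -- The positive and negative parts of `f`, in barycentric coordinates.
  let P : V →ₗ[ℝ] ℝ := ∑ x : X, max (f x) 0 • c x
  let M : V →ₗ[ℝ] ℝ := ∑ x : X, min (f x) 0 • c x
  have hPx : ∀ x : X, P x = max (f x) 0 := hinterp _
  have hMx : ∀ x : X, M x = min (f x) 0 := hinterp _
  have hP : ∀ e, 0 ≤ P (v e) := fun e ↦ by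
    simpa [P, LinearMap.sum_apply] using
      sum_nonneg fun (x : X) _ ↦ mul_nonneg (le_max_right (f x) 0) (hc x e)
  have hM : ∀ e, M (v e) ≤ 0 := fun e ↦ by
    simpa [M, LinearMap.sum_apply] using
      sum_nonpos fun (x : X) _ ↦ mul_nonpos_of_nonpos_of_nonneg (min_le_right (f x) 0) (hc x e)
  have hPM : ∀ e, P (v e) + M (v e) = f (v e) := fun e ↦ by
    rw [hrepr f e]
    simp [P, M, LinearMap.sum_apply, ← sum_add_distrib, ← add_mul, max_add_min]
  have hPM0 : ∀ e, P (v e) = 0 → M (v e) = 0 → False := fun e hPe hMe ↦ by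
    have hPe' : ∀ x : X, max (f x) 0 * c x (v e) = 0 := by
      have := (sum_eq_zero_iff_of_nonneg
        (fun (x : X) _ ↦ mul_nonneg (le_max_right (f x) 0) (hc x e))).1
        (by simpa [P, LinearMap.sum_apply] using hPe)
      simpa using this
    have hMe' : ∀ x : X, min (f x) 0 * c x (v e) = 0 := by
      have := (sum_eq_zero_iff_of_nonpos
        (fun (x : X) _ ↦ mul_nonpos_of_nonpos_of_nonneg (min_le_right (f x) 0) (hc x e))).1
        (by simpa [M, LinearMap.sum_apply] using hMe)
      simpa using this
    have hzero : ∀ x : X, c x (v e) = 0 := fun x ↦ by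
      have : f x * c x (v e) = 0 := by
        rw [← add_zero (f x), ← max_add_min (f x) 0, add_mul, hPe', hMe', add_zero]
      exact (mul_eq_zero.1 this).resolve_left (hne x x.2)
    have := hrepr π e
    simp [hπ, hzero] at this
  have hfP : ∀ e, P (v e) = 0 → f (v e) < 0 := fun e he ↦ by
    rw [← hPM e, he, zero_add]
    exact (hM e).lt_of_ne fun h ↦ hPM0 e he h
  have hfM : ∀ e, M (v e) = 0 → 0 < f (v e) := fun e he ↦ by
    rw [← hPM e, he, add_zero]
    exact (hP e).lt_of_ne' fun h ↦ hPM0 e h he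
  -- Both signs occur among the extreme points since `f` vanishes at `v p`.
  have hPex : ∃ e, P (v e) = 0 := by
    by_contra! h
    have hfx : ∀ x : X, 0 < f x := fun x ↦ by
      obtain ⟨e, he⟩ := hXv x.2
      have := h e
      rw [he, hPx x] at this
      by_contra! h'
      exact this (max_eq_right h')
    exact hPM0 p (by
      have : M = 0 := by simp [M, min_eq_right (hfx _).le]
      rw [← hp, ← hPM p, this]; simp) (by simp [M, min_eq_right (hfx _).le])
  have hMex : ∃ e, M (v e) = 0 := by
    by_contra! h
    have hfx : ∀ x : X, f x < 0 := fun x ↦ by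
      obtain ⟨e, he⟩ := hXv x.2
      have := h e
      rw [he, hMx x] at this
      by_contra! h'
      exact this (min_eq_right h')
    exact hPM0 p (by simp [P, max_eq_right (hfx _).le]) (by
      have : P = 0 := by simp [P, max_eq_right (hfx _).le]
      rw [← hp, ← hPM p, this]; simp)
  let g : ℕ → V →ₗ[ℝ] ℝ
    | 0 => π
    | 1 => P
    | 2 => f
    | 3 => M
    | _ + 4 => -π
  have hg : ∀ i e, g i (v e) ≤ 0 → g (i + 1) (v e) < 0 := fun i e ↦ by
    match i with
    | 0 => simp [g, hπ]
    | 1 => exact fun h ↦ hfP e (h.antisymm (hP e))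
    | 2 => exact fun h ↦ (hM e).lt_of_ne fun h' ↦ (hfM e h').not_ge h
    | 3 => simp [g, hπ]
    | _ + 4 => simp [g, hπ]
  have hI : ∀ i ∈ ({1, 2, 3} : Finset ℕ), ∃ e, g i (v e) = 0 := by
    simp only [mem_insert, mem_singleton, forall_eq_or_imp, forall_eq]
    exact ⟨hPex, ⟨p, hp⟩, hMex⟩
  obtain ⟨l, b, hb, hl, hsum⟩ := exists_isCellularString_of_chain (v := v) g (N := 4)
    (fun e ↦ by simp [g, hπ]) hg (fun e ↦ by simp [g, hπ]) _ hI
  refine hstr ⟨l, b, hb, le_trans (by simp) hl, le_trans ?_ hsum⟩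
  have h2 := two_le_finrank_span hπ (S := {e | f (v e) = 0}) hp hq hpq
  have hspan : Submodule.span ℝ (Set.range v) ≤
      Submodule.span ℝ (v '' {e | P (v e) = 0}) ⊔ Submodule.span ℝ (v '' {e | M (v e) = 0}) := by
    rw [← Submodule.span_union]
    refine (Submodule.span_le.2 (range_subset_span_extremePoints v)).trans
      (Submodule.span_mono fun x hx ↦ ?_)
    obtain ⟨e, rfl⟩ := hXv hx
    rcases le_total (f (v e)) 0 with h | h
    · exact Or.inl ⟨e, (hPx ⟨_, hx⟩).trans (max_eq_right h), rfl⟩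
    · exact Or.inr ⟨e, (hMx ⟨_, hx⟩).trans (min_eq_right h), rfl⟩
  have h3 := (Submodule.finrank_mono hspan).trans
    (Submodule.finrank_add_le_finrank_add_finrank _ _)
  simp only [mem_insert, mem_singleton, OfNat.one_ne_ofNat, Nat.reduceEqDiff, or_self,
    not_false_eq_true, sum_insert, sum_singleton, g, blockDim]
  omega

end NoLongStrings

/-- Under the hypotheses of the classification (no cellular string with
`l ≥ 2` and `∑ (dim span E_i − 1) ≥ r − 1`), any two distinct non-extreme points
`a₁, a₂ ∈ P = {v e : e ∈ E}` are collinear with some extreme point `b` of `conv P`. -/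
theorem statement16 {E : Type*} [Fintype E] {d : ℕ}
    (v : E → Fin d → ℝ) (π : (Fin d → ℝ) →ₗ[ℝ] ℝ)
    (hπ : ∀ e, π (v e) = 1)
    (hinj : Function.Injective v)
    (r : ℕ) (hr : r = Module.finrank ℝ (Submodule.span ℝ (Set.range v)))
    (hstr : ¬ ∃ (l : ℕ) (b : E → Fin l), IsCellularString v l b ∧ 2 ≤ l ∧
      (r : ℤ) - 1 ≤ ∑ i : Fin l,
        ((Module.finrank ℝ (Submodule.span ℝ (v '' {e | b e = i})) : ℤ) - 1))
    (a₁ a₂ : Fin d → ℝ) (ha₁ : a₁ ∈ Set.range v) (ha₂ : a₂ ∈ Set.range v)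
    (hne : a₁ ≠ a₂)
    (hext₁ : a₁ ∉ (convexHull ℝ (Set.range v)).extremePoints ℝ)
    (hext₂ : a₂ ∉ (convexHull ℝ (Set.range v)).extremePoints ℝ) :
    ∃ b ∈ (convexHull ℝ (Set.range v)).extremePoints ℝ,
      Collinear ℝ {a₁, a₂, b} := by
  obtain ⟨p, rfl⟩ := ha₁
  obtain ⟨q, rfl⟩ := ha₂
  subst hr
  set X := (convexHull ℝ (Set.range v)).extremePoints ℝ with hX
  have hXv : X ⊆ Set.range v := extremePoints_convexHull_subset
  have : Finite X := (Set.finite_range v).subset hXv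
  by_contra! hcol
  set L := Submodule.span ℝ {v p, v q} with hL
  have hXL : ∀ x : X, L.mkQ x ≠ 0 := by
    rintro ⟨x, hx⟩ h0
    obtain ⟨e, rfl⟩ := hXv hx
    rw [Submodule.mkQ_apply, Submodule.Quotient.mk_eq_zero] at h0
    exact hcol _ hx (collinear_of_mem_span_pair (hπ p) (hπ q) (hπ e) h0)
  obtain ⟨f, hf⟩ := Module.exists_dual_forall_apply_ne_zero (K := ℝ) (fun x : X ↦ L.mkQ x) hXL
  have hfL : ∀ y ∈ L, (f ∘ₗ L.mkQ) y = 0 := fun y hy ↦ by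
    simp [(Submodule.Quotient.mk_eq_zero L).2 hy]
  obtain ⟨x, hx, hfx⟩ := exists_mem_extremePoints_apply_eq_zero hπ hstr hne
    (hfL _ (Submodule.subset_span (by simp))) (hfL _ (Submodule.subset_span (by simp)))
  exact hf ⟨x, hx⟩ hfx
end
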